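/- Fundamental gap estimate for the Dirichlet p-Laplacian (Corollary 3.4): Let p ≥ 2, n ≥ 2, and let Ω ⊂ ℝⁿ be an open bounded convex set with smooth boundary, of diameter diam(Ω). Let u₁ be a first Dirichlet eigenfunction (positive in Ω, log u₁ concave) with ∫_Ω |u₁|^p dx = 1, and let u₂ be a second eigenfunction, i.e. a weak solution of −div(|∇u₂|^{p−2}∇u₂) = λ₂(p,Ω)|u₂|^{p−2}u₂ vanishing on ∂Ω with ∫_Ω |u₂|^p dx = 1 and ∫_Ω |∇u₂|^p dx = λ₂(p,Ω), to which the stability inequality extends by density. Then λ₂(p,Ω) − λ₁(p,Ω) ≥ 2^{2−p} (π_p / diam(Ω))^p · inf_{c∈ℝ} ∫_Ω |u₂ − c·u₁|^p dx. -/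

import Mathlib

open MeasureTheory Real Filter
open scoped RealInnerProductSpace

/-- `π_p = 2π (p-1)^{1/p} / (p sin(π/p))`. -/
noncomputable def piP (p : ℝ) : ℝ :=
  2 * Real.pi * (p - 1) ^ (1 / p) / (p * Real.sin (Real.pi / p))

/-- The first Dirichlet eigenvalue of the `p`-Laplacian on `Ω`, defined as the infimum of the
Rayleigh quotients over smooth nontrivial functions compactly supported in `Ω`. -/
noncomputable def lambda1 (n : ℕ) (p : ℝ) (Ω : Set (EuclideanSpace ℝ (Fin n))) : ℝ :=
  sInf { r : ℝ | ∃ u : EuclideanSpace ℝ (Fin n) → ℝ,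
    ContDiff ℝ (⊤ : ℕ∞) u ∧ HasCompactSupport u ∧ tsupport u ⊆ Ω ∧ u ≠ 0 ∧
    r = (∫ x in Ω, ‖gradient u x‖ ^ p) / (∫ x in Ω, |u x| ^ p) }

/-- The weighted Young inequality behind the Riccati barrier. -/
lemma young_barrier {p q : ℝ} (hpq : p.HolderConjugate q) (a b : ℝ) {y : ℝ} (hy : 0 ≤ y) :
    y * (q * |a| ^ (q - 2) * a * b) ≤ |b| ^ q + (q - 1) * y ^ p * |a| ^ q := by
  have hq : 1 < q := hpq.symm.lt
  have h := Real.young_inequality_of_nonneg (abs_nonneg b)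
    (mul_nonneg hy (Real.rpow_nonneg (abs_nonneg a) (q - 1))) hpq.symm
  have e1 : (y * |a| ^ (q - 1)) ^ p = y ^ p * |a| ^ q := by
    rw [Real.mul_rpow hy (by positivity), ← Real.rpow_mul (abs_nonneg a)]
    congr 2
    have := hpq.symm.sub_one_mul_conj
    linarith
  have e2 : q / p = q - 1 := by
    have := hpq.symm.div_conj_eq_sub_one
    linarith
  have e3 : |a| ^ (q - 2) * a * b ≤ |a| ^ (q - 1) * |b| := by
    rcases eq_or_ne a 0 with rfl | ha
    · simp; positivity
    · have : |a| ^ (q - 1) = |a| ^ (q - 2) * |a| := by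
        rw [← Real.rpow_add_one (abs_pos.2 ha).ne']; congr 1; ring
      rw [this, mul_assoc, mul_assoc, ← abs_mul]
      exact mul_le_mul_of_nonneg_left (le_abs_self _) (by positivity)
  have hq0 : 0 < q := by linarith
  calc y * (q * |a| ^ (q - 2) * a * b) = q * (y * (|a| ^ (q - 2) * a * b)) := by ring
    _ ≤ q * (y * (|a| ^ (q - 1) * |b|)) := by gcongr
    _ = q * (|b| * (y * |a| ^ (q - 1))) := by ring
    _ ≤ q * (|b| ^ q / q + (y * |a| ^ (q - 1)) ^ p / p) := by gcongr
    _ = |b| ^ q + (q / p) * (y ^ p * |a| ^ q) := by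
        rw [e1]; field_simp
    _ = _ := by rw [e2]; ring

/-- One-sided weighted Hardy inequality with exponential weight, obtained from a Riccati barrier
parametrised by its own value. -/
lemma hardy_exp_weight {p q : ℝ} (hpq : p.HolderConjugate q) {lam m Y s : ℝ} (hY : 0 ≤ Y)
    {k : ℝ → ℝ} (hk : Continuous k) (hk0 : ∀ y, 0 ≤ k y)
    (hk1 : ∀ y, 0 ≤ y → k y * (lam + (q - 1) * y ^ p + m * y) ≤ 1)
    {N N' : ℝ → ℝ} (hN : ∀ t, HasDerivAt N (N' t) t) (hN' : Continuous N')
    (h0 : N (s - ∫ y in (0 : ℝ)..Y, k y) = 0) :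
    0 ≤ ∫ t in (s - ∫ y in (0 : ℝ)..Y, k y)..s,
      (|N' t| ^ q - lam * |N t| ^ q) * Real.exp (m * t) := by
  have hq : 1 < q := hpq.symm.lt
  have hNc : Continuous N := continuous_iff_continuousAt.2 fun t => (hN t).continuousAt
  set T : ℝ → ℝ := fun y => s - ∫ z in (0 : ℝ)..y, k z with hT
  have hTd : ∀ y, HasDerivAt T (-k y) y := fun y => by
    simpa using (intervalIntegral.integral_hasDerivAt_right (hk.intervalIntegrable 0 y)
      hk.stronglyMeasurable.stronglyMeasurableAtFilter hk.continuousAt).const_sub s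
  have hTc : Continuous T := continuous_iff_continuousAt.2 fun t => (hTd t).continuousAt
  set h : ℝ → ℝ := fun t => (|N' t| ^ q - lam * |N t| ^ q) * Real.exp (m * t) with hh
  have hhc : Continuous h := by
    have h1 : Continuous fun t => |N' t| ^ q :=
      hN'.abs.rpow_const fun _ => Or.inr (by linarith)
    have h2 : Continuous fun t => |N t| ^ q :=
      hNc.abs.rpow_const fun _ => Or.inr (by linarith)
    fun_prop
  have hsub : ∫ y in (0 : ℝ)..Y, h (T y) * (-k y) = ∫ t in s..T Y, h t := by
    have := intervalIntegral.integral_comp_mul_deriv (a := 0) (b := Y) (f := T)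
      (f' := fun y => -k y) (g := h) (fun y _ => hTd y) hk.neg.continuousOn hhc
    simpa [hT, Function.comp_def] using this
  let D : ℝ → ℝ := fun y => y * |N (T y)| ^ q * Real.exp (m * T y)
  let D' : ℝ → ℝ := fun y => (|N (T y)| ^ q
    - k y * (y * (q * |N (T y)| ^ (q - 2) * N (T y) * N' (T y)))
    - k y * (m * y) * |N (T y)| ^ q) * Real.exp (m * T y)
  have hD : ∀ y, HasDerivAt D (D' y) y := fun y => by
    have h1 : HasDerivAt (fun y => |N (T y)| ^ q)
        (q * |N (T y)| ^ (q - 2) * N (T y) * (N' (T y) * (-k y))) y :=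
      HasDerivAt.comp (h₂ := fun x : ℝ => |x| ^ q) y (hasDerivAt_abs_rpow (N (T y)) hq)
        (HasDerivAt.comp y (hN (T y)) (hTd y))
    have h2 : HasDerivAt (fun y => Real.exp (m * T y)) (Real.exp (m * T y) * (m * (-k y))) y :=
      ((hTd y).const_mul m).exp
    convert! ((hasDerivAt_id y).mul h1).mul h2 using 1
    simp [D']; ring
  have hle : ∀ y ∈ Set.Icc 0 Y, h (T y) * (-k y) ≤ D' y := by
    intro y hy
    have hyo := young_barrier hpq (N (T y)) (N' (T y)) hy.1
    have h1 := hk1 y hy.1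
    have h3 := mul_le_mul_of_nonneg_left hyo (hk0 y)
    have h4 := mul_le_mul_of_nonneg_right h1 (Real.rpow_nonneg (abs_nonneg (N (T y))) q)
    simp only [hh, D']
    rw [mul_right_comm]
    refine mul_le_mul_of_nonneg_right ?_ (Real.exp_pos _).le
    nlinarith
  have hDc : Continuous D := continuous_iff_continuousAt.2 fun t => (hD t).continuousAt
  have hInt := intervalIntegral.integral_le_sub_of_hasDeriv_right_of_le hY hDc.continuousOn
    (fun x _ => (hD x).hasDerivWithinAt) ((hhc.comp hTc).mul hk.neg).continuousOn.integrableOn_Icc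
    (fun x hx => hle x (Set.Ioo_subset_Icc_self hx))
  have hDY : D Y = 0 := by
    have : N (T Y) = 0 := h0
    simp [D, this, Real.zero_rpow (by linarith : q ≠ 0)]
  have hD0 : D 0 = 0 := by simp [D]
  rw [hDY, hD0] at hInt
  have h5 : ∫ y in (0 : ℝ)..Y, h (T y) * (-k y) ≤ 0 := by simpa using hInt
  rw [hsub] at h5
  change 0 ≤ ∫ t in T Y..s, h t
  rw [intervalIntegral.integral_symm]
  linarith

lemma setIntegral_superlevel_nonneg {a b : ℝ} {h κ : ℝ → ℝ}
    (hκ : AntitoneOn κ (Set.Icc a b))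
    (hInt : ∀ s ∈ Set.Icc a b, 0 ≤ ∫ t in a..s, h t) (r : ℝ) :
    0 ≤ ∫ t in Set.Ioc a b ∩ {t | r < κ t}, h t := by
  set A := Set.Ioc a b ∩ {t | r < κ t} with hA
  rcases A.eq_empty_or_nonempty with h0 | ⟨t₀, ht₀⟩
  · simp [h0]
  have hbdd : BddAbove A := ⟨b, fun t ht => ht.1.2⟩
  have hs1 : a ≤ sSup A := ht₀.1.1.le.trans (le_csSup hbdd ht₀)
  have hs2 : sSup A ≤ b := csSup_le ⟨t₀, ht₀⟩ fun t ht => ht.1.2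
  have hAe : A =ᵐ[volume] Set.Ioc a (sSup A) := by
    have hsub1 : A ⊆ Set.Ioc a (sSup A) := fun t ht => ⟨ht.1.1, le_csSup hbdd ht⟩
    have hsub2 : Set.Ioo a (sSup A) ⊆ A := by
      intro t ht
      obtain ⟨t', ht', htt'⟩ := exists_lt_of_lt_csSup ⟨t₀, ht₀⟩ ht.2
      have htI : t ∈ Set.Ioc a b := ⟨ht.1, ht.2.le.trans hs2⟩
      exact ⟨htI, lt_of_lt_of_le ht'.2
        (hκ ⟨ht.1.le, htI.2⟩ ⟨ht'.1.1.le, ht'.1.2⟩ htt'.le)⟩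
    exact (hsub1.eventuallyLE).antisymm
      ((Ioo_ae_eq_Ioc (μ := volume) (a := a) (b := sSup A)).symm.le.trans hsub2.eventuallyLE)
  rw [setIntegral_congr_set hAe, ← intervalIntegral.integral_of_le hs1]
  exact hInt _ ⟨hs1, hs2⟩

/-- A function with nonnegative primitive has nonnegative integral against nonnegative
nonincreasing weights. -/
lemma integral_mul_antitone_nonneg {a b : ℝ} (hab : a ≤ b) {h κ : ℝ → ℝ} (hh : Continuous h)
    (hκc : Continuous κ) (hκ : AntitoneOn κ (Set.Icc a b)) (hκ0 : ∀ t ∈ Set.Icc a b, 0 ≤ κ t)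
    (hInt : ∀ s ∈ Set.Icc a b, 0 ≤ ∫ t in a..s, h t) :
    0 ≤ ∫ t in a..b, h t * κ t := by
  rw [intervalIntegral.integral_of_le hab]
  have e1 : ∀ t ∈ Set.Ioc a b, h t * κ t
      = ∫ r in Set.Ioc 0 (κ a), Set.indicator {x : ℝ × ℝ | x.2 < κ x.1} (fun x => h x.1) (t, r) := by
    intro t ht
    have ht' : t ∈ Set.Icc a b := ⟨ht.1.le, ht.2⟩
    have hle : κ t ≤ κ a := hκ ⟨le_rfl, hab⟩ ht' ht'.1
    have : ∀ r, Set.indicator {x : ℝ × ℝ | x.2 < κ x.1} (fun x => h x.1) (t, r)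
        = Set.indicator (Set.Iio (κ t)) (fun _ => h t) r := by
      intro r
      by_cases hr : r < κ t <;> simp [Set.indicator, hr]
    simp_rw [this]
    rw [setIntegral_indicator measurableSet_Iio]
    have hI : Set.Ioc 0 (κ a) ∩ Set.Iio (κ t) = Set.Ioo 0 (κ t) := by
      ext r; simp only [Set.mem_inter_iff, Set.mem_Ioc, Set.mem_Iio, Set.mem_Ioo]
      constructor
      · rintro ⟨⟨h1, h2⟩, h3⟩; exact ⟨h1, h3⟩
      · rintro ⟨h1, h3⟩; exact ⟨⟨h1, by linarith⟩, h3⟩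
    rw [hI, setIntegral_const]
    simp [measureReal_def, hκ0 t ht', mul_comm]
  rw [setIntegral_congr_fun measurableSet_Ioc e1]
  have hmeas : MeasurableSet {x : ℝ × ℝ | x.2 < κ x.1} :=
    (isOpen_lt continuous_snd (hκc.comp continuous_fst)).measurableSet
  obtain ⟨C, hC⟩ := isCompact_Icc.exists_bound_of_continuousOn (hh.continuousOn (s := Set.Icc a b))
  rw [integral_integral_swap]
  · refine integral_nonneg fun r => ?_
    have : ∀ t, Set.indicator {x : ℝ × ℝ | x.2 < κ x.1} (fun x => h x.1) (t, r)
        = Set.indicator {t | r < κ t} h t := by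
      intro t
      by_cases hr : r < κ t <;> simp [Set.indicator, hr]
    simp_rw [this]
    rw [setIntegral_indicator (measurableSet_lt measurable_const hκc.measurable)]
    exact setIntegral_superlevel_nonneg hκ hInt r
  · rw [Measure.prod_restrict]
    refine Measure.integrableOn_of_bounded (M := C) ?_ ?_ ?_
    · rw [Measure.prod_prod]; simp [ENNReal.mul_eq_top]
    · exact ((hh.comp continuous_fst).measurable.indicator hmeas).aestronglyMeasurable
    · refine (ae_restrict_iff' (measurableSet_Ioc.prod measurableSet_Ioc)).2
        (Eventually.of_forall fun x hx => ?_)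
      exact (norm_indicator_le_norm_self (fun x : ℝ × ℝ => h x.1) x).trans
        (hC x.1 ⟨hx.1.1.le, hx.1.2⟩)

/-- The travel-time density of the Riccati barrier with drift `m`. -/
noncomputable def barrierSpeed (lam p q m y : ℝ) : ℝ :=
  (1 - m * |y| / (lam + (q - 1) * |y| ^ p + |m| * |y|)) / (lam + (q - 1) * |y| ^ p)

section
variable {lam p q : ℝ}

lemma barrier_base_pos (hlam : 0 < lam) (hq : 1 < q) (y : ℝ) : 0 < lam + (q - 1) * |y| ^ p := by
  have : 0 ≤ (q - 1) * |y| ^ p := mul_nonneg (by linarith) (by positivity)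
  linarith

lemma barrierSpeed_pos (hlam : 0 < lam) (hq : 1 < q) (m y : ℝ) : 0 < barrierSpeed lam p q m y := by
  have h := barrier_base_pos (p := p) hlam hq y
  have h2 : 0 ≤ |m| * |y| := by positivity
  refine div_pos ?_ h
  rw [sub_pos, div_lt_one (by linarith)]
  have : m * |y| ≤ |m| * |y| := mul_le_mul_of_nonneg_right (le_abs_self m) (abs_nonneg y)
  linarith

lemma barrierSpeed_add_neg (m y : ℝ) :
    barrierSpeed lam p q m y + barrierSpeed lam p q (-m) y = 2 / (lam + (q - 1) * |y| ^ p) := by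
  simp only [barrierSpeed, abs_neg]; ring

lemma barrierSpeed_le (hlam : 0 < lam) (hq : 1 < q) (m y : ℝ) :
    barrierSpeed lam p q m y ≤ 2 / (lam + (q - 1) * |y| ^ p) := by
  have := barrierSpeed_add_neg (lam := lam) (p := p) (q := q) m y
  have := barrierSpeed_pos (p := p) hlam hq (-m) y
  linarith

lemma barrierSpeed_mul_le (hlam : 0 < lam) (hq : 1 < q) (m y : ℝ) (hy : 0 ≤ y) :
    barrierSpeed lam p q m y * (lam + (q - 1) * y ^ p + m * y) ≤ 1 := by
  have h := barrier_base_pos (p := p) hlam hq y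
  simp only [barrierSpeed]
  rw [abs_of_nonneg hy] at *
  set A := lam + (q - 1) * y ^ p
  have h2 : 0 ≤ |m| * y := by positivity
  have h3 : (1 - m * y / (A + |m| * y)) / A * (A + m * y)
      = ((A + |m| * y - m * y) * (A + m * y)) / ((A + |m| * y) * A) := by
    have : A + |m| * y ≠ 0 := by linarith
    field_simp
  rw [h3, div_le_one (by positivity)]
  have : m * |m| ≤ m * m := by
    rcases le_total 0 m with hm | hm
    · rw [abs_of_nonneg hm]
    · rw [abs_of_nonpos hm]; nlinarith
  nlinarith [mul_nonneg hy hy]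

lemma continuous_barrierSpeed (hlam : 0 < lam) (hp : 0 ≤ p) (hq : 1 < q) :
    Continuous fun x : ℝ × ℝ => barrierSpeed lam p q x.1 x.2 := by
  unfold barrierSpeed
  have hr : Continuous fun x : ℝ × ℝ => |x.2| ^ p :=
    continuous_snd.abs.rpow_const fun _ => Or.inr hp
  have h1 : ∀ x : ℝ × ℝ, lam + (q - 1) * |x.2| ^ p ≠ 0 :=
    fun x => (barrier_base_pos hlam hq x.2).ne'
  have h2 : ∀ x : ℝ × ℝ, lam + (q - 1) * |x.2| ^ p + |x.1| * |x.2| ≠ 0 := fun x => by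
    have := barrier_base_pos (p := p) hlam hq x.2
    positivity
  refine Continuous.div ?_ (by fun_prop) h1
  exact continuous_const.sub (Continuous.div (by fun_prop) (by fun_prop) h2)

lemma tendsto_integral_barrierSpeed (hlam : 0 < lam) (hp : 0 ≤ p) (hq : 1 < q) (R : ℝ) :
    Tendsto (fun m : ℝ => ∫ y in (0 : ℝ)..R, barrierSpeed lam p q m y) atTop (nhds 0) := by
  have hc := continuous_barrierSpeed (p := p) hlam hp hq
  suffices h : Tendsto (fun m : ℝ => ∫ y in (0 : ℝ)..R, barrierSpeed lam p q m y) atTop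
      (nhds (∫ y in (0 : ℝ)..R, (0 : ℝ))) by simpa using h
  refine intervalIntegral.tendsto_integral_filter_of_dominated_convergence (μ := volume)
    (fun _ => 2 / lam)
    (Eventually.of_forall fun m => ?_) (Eventually.of_forall fun m => ?_)
    (continuous_const.intervalIntegrable 0 R) ?_
  · exact (hc.comp (Continuous.prodMk continuous_const continuous_id)).aestronglyMeasurable
  · refine Eventually.of_forall fun y _ => ?_
    rw [Real.norm_of_nonneg (barrierSpeed_pos hlam hq m y).le]
    refine (barrierSpeed_le hlam hq m y).trans ?_
    have : 0 ≤ (q - 1) * |y| ^ p := mul_nonneg (by linarith) (by positivity)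
    gcongr; linarith
  · have h1 : ∀ᵐ y : ℝ, y ≠ 0 := compl_mem_ae_iff.2 (measure_singleton 0)
    filter_upwards [h1] with y hy _
    have hA := barrier_base_pos (p := p) hlam hq y
    set A := lam + (q - 1) * |y| ^ p with hAdef
    have hy' : 0 < |y| := abs_pos.2 hy
    have h3 : (fun m => barrierSpeed lam p q m y) =ᶠ[atTop] fun m => (A + m * |y|)⁻¹ := by
      filter_upwards [eventually_ge_atTop 0] with m hm
      simp only [barrierSpeed, ← hAdef, abs_of_nonneg hm]
      have : A + m * |y| ≠ 0 := by positivity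
      field_simp
      ring
    refine Tendsto.congr' h3.symm (tendsto_inv_atTop_zero.comp ?_)
    exact tendsto_atTop_add_const_left _ _ (tendsto_id.atTop_mul_const hy')

end

/-- A continuous curve `m ↦ (t m, m)` running from the right to the left endpoint meets the
subdifferential graph of a convex function. -/
lemma exists_supporting_slope {α β : ℝ} {V t : ℝ → ℝ} (hV : ConvexOn ℝ (Set.Icc α β) V)
    (hVc : ContinuousOn V (Set.Icc α β)) (ht : Continuous t) (htI : ∀ m, t m ∈ Set.Icc α β)
    {m₁ m₂ : ℝ} (h₁ : t m₁ = β) (h₂ : t m₂ = α) :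
    ∃ m, ∀ x ∈ Set.Icc α β, V (t m) + m * (x - t m) ≤ V x := by
  by_contra! hcon
  have hVt : Continuous fun m => V (t m) := hVc.comp_continuous ht htI
  have hVm : ∀ x, Continuous fun m => V (t m) + m * (x - t m) := fun x =>
    hVt.add (continuous_id.mul (continuous_const.sub ht))
  let U : Set ℝ := ⋃ x ∈ Set.Icc α β, {m | t m < x ∧ V x < V (t m) + m * (x - t m)}
  let W : Set ℝ := ⋃ x ∈ Set.Icc α β, {m | x < t m ∧ V x < V (t m) + m * (x - t m)}
  have hU : IsOpen U := isOpen_biUnion fun x _ =>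
    (isOpen_lt ht continuous_const).inter (isOpen_lt continuous_const (hVm x))
  have hW : IsOpen W := isOpen_biUnion fun x _ =>
    (isOpen_lt continuous_const ht).inter (isOpen_lt continuous_const (hVm x))
  have hcov : ∀ m, m ∈ U ∪ W := fun m => by
    obtain ⟨x, hx, hlt⟩ := hcon m
    rcases lt_trichotomy (t m) x with h | h | h
    · exact Or.inl (Set.mem_biUnion hx ⟨h, hlt⟩)
    · rw [← h] at hlt; simp at hlt
    · exact Or.inr (Set.mem_biUnion hx ⟨h, hlt⟩)
  have hm₂ : m₂ ∈ U := (hcov m₂).resolve_right fun h => by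
    simp only [W, Set.mem_iUnion, Set.mem_ofPred_eq] at h
    obtain ⟨x, hx, h, -⟩ := h
    rw [h₂] at h; exact absurd hx.1 (not_le.2 h)
  have hm₁ : m₁ ∈ W := (hcov m₁).resolve_left fun h => by
    simp only [U, Set.mem_iUnion, Set.mem_ofPred_eq] at h
    obtain ⟨x, hx, h, -⟩ := h
    rw [h₁] at h; exact absurd hx.2 (not_le.2 h)
  obtain ⟨m, -, hmU, hmW⟩ := isPreconnected_univ (α := ℝ) U W hU hW (fun m _ => hcov m)
    ⟨m₂, trivial, hm₂⟩ ⟨m₁, trivial, hm₁⟩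
  simp only [U, W, Set.mem_iUnion, Set.mem_ofPred_eq] at hmU hmW
  obtain ⟨x, hx, hx1, hx2⟩ := hmU
  obtain ⟨z, hz, hz1, hz2⟩ := hmW
  set s := t m
  have hd : 0 < x - z := by linarith
  have hc := hV.2 hz hx (show 0 ≤ (x - s) / (x - z) from div_nonneg (by linarith) hd.le)
    (show 0 ≤ (s - z) / (x - z) from div_nonneg (by linarith) hd.le)
    (by field_simp; ring)
  have e : ((x - s) / (x - z)) • z + ((s - z) / (x - z)) • x = s := by
    simp only [smul_eq_mul]; field_simp; ring
  rw [e] at hc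
  simp only [smul_eq_mul] at hc
  have h3 : V s * (x - z) ≤ (x - s) * V z + (s - z) * V x := by
    have := mul_le_mul_of_nonneg_right hc hd.le
    convert! this using 1
    field_simp
  nlinarith

lemma ConvexOn.antitoneOn_left_of_isMinOn {a b s : ℝ} {F : ℝ → ℝ} (hF : ConvexOn ℝ (Set.Icc a b) F)
    (hs : s ∈ Set.Icc a b) (hmin : ∀ x ∈ Set.Icc a b, F s ≤ F x) : AntitoneOn F (Set.Icc a s) := by
  intro x hx y hy hxy
  rcases eq_or_lt_of_le hxy with rfl | hlt
  · exact le_rfl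
  have hd : 0 < s - x := by linarith [hy.2]
  have hc := hF.2 (⟨hx.1, hx.2.trans hs.2⟩ : x ∈ Set.Icc a b) hs
    (show 0 ≤ (s - y) / (s - x) from div_nonneg (by linarith [hy.2]) hd.le)
    (show 0 ≤ (y - x) / (s - x) from div_nonneg (by linarith) hd.le) (by field_simp; ring)
  have e : ((s - y) / (s - x)) • x + ((y - x) / (s - x)) • s = y := by
    simp only [smul_eq_mul]; field_simp; ring
  rw [e] at hc
  simp only [smul_eq_mul] at hc
  have h3 : F y * (s - x) ≤ (s - y) * F x + (y - x) * F s := by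
    have := mul_le_mul_of_nonneg_right hc hd.le
    convert! this using 1
    field_simp
  have h4 := hmin x ⟨hx.1, hx.2.trans hs.2⟩
  by_contra! hcon
  nlinarith

/-- The part of the weighted Dirichlet inequality to the left of the turning point. -/
lemma dirichlet_left {p q : ℝ} (hpq : p.HolderConjugate q) {lam m R a b : ℝ} (hlam : 0 < lam)
    (hR : 0 ≤ R) (hab : a ≤ b) (hT : b - a ≤ ∫ y in (0 : ℝ)..R, barrierSpeed lam p q m y)
    {N N' V : ℝ → ℝ} (hN : ∀ t, HasDerivAt N (N' t) t) (hN' : Continuous N') (h0 : N a = 0)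
    (hVc : Continuous V) (hV : AntitoneOn (fun t => V t - m * t) (Set.Icc a b)) :
    0 ≤ ∫ t in a..b, (|N' t| ^ q - lam * |N t| ^ q) * Real.exp (V t) := by
  have hq : 1 < q := hpq.symm.lt
  have hp : 0 ≤ p := hpq.nonneg
  have hk : Continuous (barrierSpeed lam p q m) :=
    (continuous_barrierSpeed (p := p) hlam hp hq).comp
      (Continuous.prodMk continuous_const continuous_id)
  have hNc : Continuous N := continuous_iff_continuousAt.2 fun t => (hN t).continuousAt
  have h1 : Continuous fun t => |N' t| ^ q := hN'.abs.rpow_const fun _ => Or.inr (by linarith)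
  have h2 : Continuous fun t => |N t| ^ q := hNc.abs.rpow_const fun _ => Or.inr (by linarith)
  have key := integral_mul_antitone_nonneg hab
    (h := fun t => (|N' t| ^ q - lam * |N t| ^ q) * Real.exp (m * t))
    (κ := fun t => Real.exp (V t - m * t)) (by fun_prop) (by fun_prop)
    (fun x hx y hy hxy => Real.exp_le_exp.2 (hV hx hy hxy)) (fun t _ => (Real.exp_pos _).le) ?_
  · convert! key using 3 with t
    rw [mul_assoc, ← Real.exp_add]; congr 2; ring
  · intro s hs
    have hcont : ContinuousOn (fun Y => ∫ y in (0 : ℝ)..Y, barrierSpeed lam p q m y)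
        (Set.Icc 0 R) :=
      (intervalIntegral.continuous_primitive (fun _ _ => hk.intervalIntegrable _ _) 0).continuousOn
    obtain ⟨Y, hY, hYs⟩ := intermediate_value_Icc hR hcont
      (show s - a ∈ Set.Icc _ _ by
        constructor
        · simpa using hs.1
        · exact (by linarith [hs.2] : s - a ≤ b - a).trans hT)
    simp only at hYs
    have e : s - ∫ y in (0 : ℝ)..Y, barrierSpeed lam p q m y = a := by rw [hYs]; ring
    have := hardy_exp_weight hpq (lam := lam) (m := m) (s := s) hY.1 hk
      (fun y => (barrierSpeed_pos hlam hq m y).le)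
      (fun y hy => barrierSpeed_mul_le hlam hq m y hy) hN hN' (by rw [e]; exact h0)
    rwa [e] at this

/-- Sharp one-dimensional Dirichlet inequality with a log-convex weight. -/
lemma dirichlet_logConvex {p q : ℝ} (hpq : p.HolderConjugate q) {lam R α β : ℝ} (hlam : 0 < lam)
    (hR : 0 ≤ R) (hαβ : α ≤ β)
    (hT : β - α < ∫ y in (0 : ℝ)..R, 2 / (lam + (q - 1) * |y| ^ p))
    {N N' V : ℝ → ℝ} (hN : ∀ t, HasDerivAt N (N' t) t) (hN' : Continuous N')
    (hα : N α = 0) (hβ : N β = 0)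
    (hVc : Continuous V) (hV : ConvexOn ℝ (Set.Icc α β) V) :
    0 ≤ ∫ t in α..β, (|N' t| ^ q - lam * |N t| ^ q) * Real.exp (V t) := by
  have hq : 1 < q := hpq.symm.lt
  have hp : 0 ≤ p := hpq.nonneg
  have hk2 := continuous_barrierSpeed (p := p) hlam hp hq
  have hk : ∀ m, Continuous (barrierSpeed lam p q m) := fun m =>
    hk2.comp (Continuous.prodMk continuous_const continuous_id)
  set T : ℝ → ℝ := fun m => ∫ y in (0 : ℝ)..R, barrierSpeed lam p q m y with hTdef
  have hTc : Continuous T :=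
    intervalIntegral.continuous_parametric_intervalIntegral_of_continuous' hk2 0 R
  have hT0 : ∀ m, 0 ≤ T m := fun m =>
    intervalIntegral.integral_nonneg hR fun y _ => (barrierSpeed_pos hlam hq m y).le
  set d := ∫ y in (0 : ℝ)..R, 2 / (lam + (q - 1) * |y| ^ p) with hd
  have hTadd : ∀ m, T m + T (-m) = d := fun m => by
    simp only [hTdef, hd]
    rw [← intervalIntegral.integral_add ((hk m).intervalIntegrable _ _)
      ((hk (-m)).intervalIntegrable _ _)]
    simp_rw [barrierSpeed_add_neg]
  set ε := d - (β - α) with hε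
  have hεpos : 0 < ε := by linarith
  set t : ℝ → ℝ := fun m => max α (min β (α - ε / 2 + T m)) with ht
  have htc : Continuous t := by fun_prop
  have htI : ∀ m, t m ∈ Set.Icc α β := fun m =>
    ⟨le_max_left _ _, max_le hαβ (min_le_left _ _)⟩
  obtain ⟨M, hM⟩ := ((tendsto_integral_barrierSpeed (p := p) hlam hp hq R).eventually
    (gt_mem_nhds (by linarith : 0 < ε / 2))).exists
  have hM' : T M < ε / 2 := hM
  have h2 : t M = α := by
    simp only [ht]
    exact max_eq_left ((min_le_right _ _).trans (by linarith))
  have h1 : t (-M) = β := by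
    have := hTadd M
    simp only [ht]
    rw [min_eq_left (by linarith), max_eq_right hαβ]
  obtain ⟨m, hm⟩ := exists_supporting_slope hV hVc.continuousOn htc htI h1 h2
  set s := t m with hs
  have hsI : s ∈ Set.Icc α β := htI m
  have hsl : s - α ≤ T m := by
    rcases max_choice α (min β (α - ε / 2 + T m)) with h | h
    · have : s = α := h
      linarith [hT0 m]
    · have : s ≤ α - ε / 2 + T m := h.le.trans (min_le_right _ _)
      linarith
  have hsr : β - s ≤ T (-m) := by
    have h3 := hTadd m
    have h4 : min β (α - ε / 2 + T m) ≤ s := le_max_right _ _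
    rcases min_choice β (α - ε / 2 + T m) with h | h
    · linarith [hT0 (-m)]
    · linarith
  have hF : ConvexOn ℝ (Set.Icc α β) fun x => V x - m * x := by
    refine hV.sub ?_
    exact ((LinearMap.mul ℝ ℝ m).concaveOn (convex_Icc α β))
  have hmin : ∀ x ∈ Set.Icc α β, V s - m * s ≤ V x - m * x := fun x hx => by
    have := hm x hx
    linarith
  have hNc : Continuous N := continuous_iff_continuousAt.2 fun t => (hN t).continuousAt
  have c1 : Continuous fun t => |N' t| ^ q := hN'.abs.rpow_const fun _ => Or.inr (by linarith)
  have c2 : Continuous fun t => |N t| ^ q := hNc.abs.rpow_const fun _ => Or.inr (by linarith)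
  have hc : Continuous fun t => (|N' t| ^ q - lam * |N t| ^ q) * Real.exp (V t) := by fun_prop
  rw [← intervalIntegral.integral_add_adjacent_intervals (hc.intervalIntegrable α s)
    (hc.intervalIntegrable s β)]
  have hleft := dirichlet_left hpq hlam hR hsI.1 hsl hN hN' hα hVc
    (hF.antitoneOn_left_of_isMinOn hsI hmin)
  have hF' : ConvexOn ℝ (Set.Icc (-β) (-α)) fun x => V (-x) - (-m) * x := by
    have := hF.comp_linearMap (-LinearMap.id : ℝ →ₗ[ℝ] ℝ)
    convert! this using 1
    · ext x; simp [neg_le, le_neg, and_comm]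
    · ext x; simp
  have hright := dirichlet_left hpq (N := fun t => N (-t)) (N' := fun t => -N' (-t))
    (V := fun t => V (-t)) hlam hR (a := -β) (b := -s) (m := -m) (by linarith [hsI.2])
    (by linarith)
    (fun t => by
      have := HasDerivAt.comp t (hN (-t)) (hasDerivAt_neg t)
      simpa [Function.comp_def] using this)
    (by fun_prop) (by simpa using hβ) (by fun_prop)
    (hF'.antitoneOn_left_of_isMinOn (s := -s) ⟨by linarith [hsI.2], by linarith [hsI.1]⟩
      fun x hx => by
        have := hmin (-x) ⟨by linarith [hx.2], by linarith [hx.1]⟩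
        simp only [neg_neg]; linarith)
  have e := intervalIntegral.integral_comp_neg (a := -β) (b := -s)
    (fun t => (|N' t| ^ q - lam * |N t| ^ q) * Real.exp (V t))
  simp only [neg_neg] at e
  simp only [abs_neg] at hright
  rw [e] at hright
  exact add_nonneg hleft hright

lemma lintegral_inv_add_rpow {p lam c : ℝ} (hp : 1 < p) (hlam : 0 < lam) (hc : 0 < c) :
    ∫⁻ y in Set.Ioi (0 : ℝ), ENNReal.ofReal ((lam + c * y ^ p)⁻¹)
      = ENNReal.ofReal (c ^ (-1 / p) * lam ^ (-(1 - 1 / p)) * (π / (p * Real.sin (π / p)))) := by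
  have hp0 : 0 < p := by linarith
  have hp1 : 1 / p < 1 := by rw [div_lt_one hp0]; exact hp
  have hpos : 0 < 1 / p := by positivity
  have hlaplace : ∀ y ∈ Set.Ioi (0 : ℝ), ENNReal.ofReal ((lam + c * y ^ p)⁻¹)
      = ∫⁻ s in Set.Ioi (0 : ℝ), ENNReal.ofReal (Real.exp (-(lam + c * y ^ p) * s)) := by
    intro y hy
    have hB : 0 < lam + c * y ^ p := by
      have : 0 < y ^ p := Real.rpow_pos_of_pos hy p
      positivity
    rw [← ofReal_integral_eq_lintegral_ofReal (integrableOn_exp_mul_Ioi (by linarith) 0)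
      (Eventually.of_forall fun s => (Real.exp_pos _).le), integral_exp_mul_Ioi (by linarith)]
    congr 1
    field_simp
    simp
  rw [setLIntegral_congr_fun measurableSet_Ioi hlaplace]
  rw [lintegral_lintegral_swap (by
    apply Measurable.aemeasurable
    unfold Function.uncurry
    fun_prop)]
  have hgamma : ∀ s ∈ Set.Ioi (0 : ℝ),
      ∫⁻ y in Set.Ioi (0 : ℝ), ENNReal.ofReal (Real.exp (-(lam + c * y ^ p) * s))
      = ENNReal.ofReal (c ^ (-1 / p) * Gamma (1 / p + 1)
        * (s ^ ((1 - 1 / p) - 1) * Real.exp (-(lam * s)))) := by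
    intro s hs
    have hs' : 0 < s := hs
    have hInt := integral_exp_neg_mul_rpow hp0 (mul_pos hs' hc)
    have hG : 0 < Gamma (1 / p + 1) := Real.Gamma_pos_of_pos (by linarith)
    have hne : ∫ x in Set.Ioi (0 : ℝ), Real.exp (-(s * c) * x ^ p) ≠ 0 := by
      rw [hInt]; positivity
    have e1 : ∀ y : ℝ, ENNReal.ofReal (Real.exp (-(lam + c * y ^ p) * s))
        = ENNReal.ofReal (Real.exp (-(lam * s))) *
          ENNReal.ofReal (Real.exp (-(s * c) * y ^ p)) := by
      intro y
      rw [← ENNReal.ofReal_mul (Real.exp_pos _).le, ← Real.exp_add]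
      congr 2; ring
    simp_rw [e1]
    rw [lintegral_const_mul' _ _ ENNReal.ofReal_ne_top,
      ← ofReal_integral_eq_lintegral_ofReal (Integrable.of_integral_ne_zero hne)
      (Eventually.of_forall fun s => (Real.exp_pos _).le), hInt,
      ← ENNReal.ofReal_mul (Real.exp_pos _).le, Real.mul_rpow hs'.le hc.le]
    congr 1
    have : (1 - 1 / p) - 1 = -1 / p := by ring
    rw [this]; ring
  rw [setLIntegral_congr_fun measurableSet_Ioi hgamma]
  have hInt := integral_rpow_mul_exp_neg_mul_Ioi (a := 1 - 1 / p) (by linarith) hlam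
  have hG1 : 0 < Gamma (1 - 1 / p) := Real.Gamma_pos_of_pos (by linarith)
  have hG : 0 < Gamma (1 / p + 1) := Real.Gamma_pos_of_pos (by linarith)
  have hne : ∫ s in Set.Ioi (0 : ℝ), s ^ ((1 - 1 / p) - 1) * Real.exp (-(lam * s)) ≠ 0 := by
    rw [hInt]; positivity
  rw [← ofReal_integral_eq_lintegral_ofReal
    ((Integrable.of_integral_ne_zero hne).const_mul _)]
  · rw [integral_const_mul, hInt]
    congr 1
    have h1 := Real.Gamma_mul_Gamma_one_sub (1 / p)
    rw [Real.Gamma_add_one hpos.ne', one_div lam, Real.inv_rpow hlam.le, ← Real.rpow_neg hlam.le]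
    have e : π * (1 / p) = π / p := by ring
    rw [e] at h1
    calc _ = c ^ (-1 / p) * lam ^ (-(1 - 1 / p)) *
          (1 / p * (Gamma (1 / p) * Gamma (1 - 1 / p))) := by ring
      _ = _ := by rw [h1]; congr 1; rw [div_mul_div_comm, one_mul]
  · refine (ae_restrict_iff' measurableSet_Ioi).2 (Eventually.of_forall fun s hs => ?_)
    have hs' : 0 < s := hs
    simp only [Pi.zero_apply]; positivity

lemma piP_pos {p : ℝ} (hp : 1 < p) : 0 < piP p := by
  have h : 0 < Real.sin (π / p) := Real.sin_pos_of_pos_of_lt_pi (by positivity)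
    (div_lt_self Real.pi_pos hp)
  have : 0 < p - 1 := by linarith
  unfold piP; positivity

/-- The barrier survives on every interval of length less than `π_p / L`. -/
lemma exists_barrier_length {p q : ℝ} (hpq : p.HolderConjugate q) {d L : ℝ} (hL : 0 < L)
    (hd : d * L < piP p) :
    ∃ R : ℝ, 0 ≤ R ∧ d < ∫ y in (0 : ℝ)..R, 2 / (L ^ q + (q - 1) * |y| ^ p) := by
  have hp : 1 < p := hpq.lt
  have hq : 1 < q := hpq.symm.lt
  have hlam : 0 < L ^ q := Real.rpow_pos_of_pos hL q
  have hl := lintegral_inv_add_rpow hp hlam (by linarith : 0 < q - 1)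
  have hnn : 0 ≤ᵐ[volume.restrict (Set.Ioi (0 : ℝ))] fun y : ℝ =>
      (L ^ q + (q - 1) * y ^ p)⁻¹ := by
    refine (ae_restrict_iff' measurableSet_Ioi).2 (Eventually.of_forall fun y hy => ?_)
    have : 0 ≤ (q - 1) * y ^ p := mul_nonneg (by linarith) (Real.rpow_nonneg (le_of_lt hy) p)
    simp only [Pi.zero_apply]; positivity
  have hmeas : AEStronglyMeasurable (fun y : ℝ => (L ^ q + (q - 1) * y ^ p)⁻¹)
      (volume.restrict (Set.Ioi (0 : ℝ))) := by
    apply Measurable.aestronglyMeasurable; fun_prop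
  have hInt : IntegrableOn (fun y : ℝ => (L ^ q + (q - 1) * y ^ p)⁻¹) (Set.Ioi 0) :=
    ⟨hmeas, (hasFiniteIntegral_iff_ofReal hnn).2 (by rw [hl]; exact ENNReal.ofReal_lt_top)⟩
  have hs : 0 < Real.sin (π / p) := Real.sin_pos_of_pos_of_lt_pi (by positivity)
    (div_lt_self Real.pi_pos hp)
  have hval : ∫ y in Set.Ioi (0 : ℝ), (L ^ q + (q - 1) * y ^ p)⁻¹ = piP p / (2 * L) := by
    rw [integral_eq_lintegral_of_nonneg_ae hnn hmeas, hl, ENNReal.toReal_ofReal]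
    · have e1 : (L ^ q) ^ (-(1 - 1 / p)) = L⁻¹ := by
        rw [← Real.rpow_mul hL.le, ← Real.rpow_neg_one]
        congr 1
        have := hpq.inv_add_inv_eq_one
        have h2 : 1 - 1 / p = q⁻¹ := by rw [one_div]; linarith
        rw [h2]; field_simp
      have e2 : (q - 1) ^ (-1 / p) = (p - 1) ^ (1 / p) := by
        have h3 : q - 1 = (p - 1)⁻¹ := by
          have h4 : (p - 1) * (q - 1) = 1 := by
            have := hpq.mul_eq_add; nlinarith
          exact eq_inv_of_mul_eq_one_right h4
        rw [h3, Real.inv_rpow (by linarith), ← Real.rpow_neg (by linarith)]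
        congr 1; ring
      rw [e1, e2, piP]
      field_simp
    · have : 0 < q - 1 := by linarith
      positivity
  have htend := (intervalIntegral_tendsto_integral_Ioi 0 hInt tendsto_id).const_mul 2
  rw [hval] at htend
  have hlt : d < 2 * (piP p / (2 * L)) := by
    have : 2 * (piP p / (2 * L)) = piP p / L := by field_simp
    rw [this, lt_div_iff₀ hL]; exact hd
  obtain ⟨R, hR0, hR⟩ := ((eventually_ge_atTop (0 : ℝ)).and
    (htend.eventually (lt_mem_nhds hlt))).exists
  simp only [id] at hR
  refine ⟨R, hR0, hR.trans_eq ?_⟩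
  rw [← intervalIntegral.integral_const_mul]
  refine intervalIntegral.integral_congr fun y hy => ?_
  rw [Set.uIcc_of_le hR0] at hy
  simp only [abs_of_nonneg hy.1, div_eq_mul_inv]

/-- The signed power `|x|^{p-2} x`. -/
noncomputable def signedPow (p x : ℝ) : ℝ := |x| ^ (p - 2) * x

lemma continuous_signedPow {p : ℝ} (hp : 2 ≤ p) : Continuous (signedPow p) :=
  (continuous_abs.rpow_const fun _ => Or.inr (by linarith)).mul continuous_id

lemma abs_signedPow {p : ℝ} (hp : 2 ≤ p) (x : ℝ) : |signedPow p x| = |x| ^ (p - 1) := by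
  rw [signedPow, abs_mul, abs_of_nonneg (Real.rpow_nonneg (abs_nonneg x) _)]
  rcases eq_or_ne x 0 with rfl | hx
  · simp [Real.zero_rpow (by linarith : p - 1 ≠ 0)]
  · rw [show p - 1 = p - 2 + 1 by ring, Real.rpow_add_one (abs_pos.2 hx).ne']

lemma signedPow_mul_self {p : ℝ} (hp : 2 ≤ p) (x : ℝ) : signedPow p x * x = |x| ^ p := by
  rcases eq_or_ne x 0 with rfl | hx
  · simp [signedPow, Real.zero_rpow (by linarith : p ≠ 0)]
  · rw [signedPow, mul_assoc, ← abs_mul_abs_self x, ← mul_assoc,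
      ← Real.rpow_add_one (abs_pos.2 hx).ne', ← Real.rpow_add_one (abs_pos.2 hx).ne']
    congr 1; ring

lemma signedPow_nonneg {p x : ℝ} (hx : 0 ≤ x) : 0 ≤ signedPow p x :=
  mul_nonneg (Real.rpow_nonneg (abs_nonneg x) _) hx

lemma signedPow_nonpos {p x : ℝ} (hx : x ≤ 0) : signedPow p x ≤ 0 :=
  mul_nonpos_of_nonneg_of_nonpos (Real.rpow_nonneg (abs_nonneg x) _) hx

lemma abs_rpow_sub_ge {p : ℝ} (hp : 2 ≤ p) (g c : ℝ) :
    |g| ^ p - p * c * signedPow p g ≤ |g - c| ^ p := by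
  have hpq : p.HolderConjugate (p / (p - 1)) := Real.HolderConjugate.conjExponent (by linarith)
  have hp0 : 0 < p := by linarith
  have h := Real.young_inequality_of_nonneg (abs_nonneg (g - c)) (abs_nonneg (signedPow p g)) hpq
  have h1 : |g| ^ p - c * signedPow p g ≤ |g - c| * |signedPow p g| := by
    rw [← abs_mul, ← signedPow_mul_self hp]
    refine le_trans (le_of_eq ?_) (le_abs_self _); ring
  have h2 : |signedPow p g| ^ (p / (p - 1)) = |g| ^ p := by
    rw [abs_signedPow hp, ← Real.rpow_mul (abs_nonneg g)]
    congr 1; field_simp [show p - 1 ≠ 0 by linarith]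
  rw [h2] at h
  have h3 : |g| ^ p / (p / (p - 1)) = |g| ^ p - |g| ^ p / p := by
    have : p - 1 ≠ 0 := by linarith
    field_simp
  rw [h3] at h
  have h4 : |g| ^ p / p - c * signedPow p g ≤ |g - c| ^ p / p := by linarith
  have h5 := mul_le_mul_of_nonneg_left h4 hp0.le
  rw [mul_sub, mul_div_cancel₀ _ hp0.ne', mul_div_cancel₀ _ hp0.ne'] at h5
  linarith

/-- A bounded function has an `L^p`-centre with respect to a finite measure. -/
lemma exists_integral_signedPow_sub_eq_zero {X : Type*} [MeasurableSpace X] (μ : Measure X)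
    [IsFiniteMeasure μ] {p : ℝ} (hp : 2 ≤ p) {f : X → ℝ} (hf : AEStronglyMeasurable f μ) {M : ℝ}
    (hM : 0 ≤ M) (hfM : ∀ x, |f x| ≤ M) :
    ∃ c ∈ Set.Icc (-M) M, ∫ x, signedPow p (f x - c) ∂μ = 0 := by
  have hc : ContinuousOn (fun c => ∫ x, signedPow p (f x - c) ∂μ) (Set.Icc (-M) M) := by
    refine continuousOn_of_dominated (bound := fun _ => (M + M) ^ (p - 1)) ?_ ?_ ?_ ?_
    · intro c _
      exact (continuous_signedPow hp).comp_aestronglyMeasurable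
        (hf.sub aestronglyMeasurable_const)
    · intro c hc
      refine Eventually.of_forall fun x => ?_
      rw [Real.norm_eq_abs, abs_signedPow hp]
      refine Real.rpow_le_rpow (abs_nonneg _) ?_ (by linarith)
      exact (abs_sub _ _).trans (add_le_add (hfM x) (abs_le.2 hc))
    · exact integrable_const _
    · refine Eventually.of_forall fun x => Continuous.continuousOn ?_
      exact (continuous_signedPow hp).comp (continuous_const.sub continuous_id)
  have h1 : ∫ x, signedPow p (f x - M) ∂μ ≤ 0 :=
    integral_nonpos fun x => signedPow_nonpos (by have := (abs_le.1 (hfM x)).2; linarith)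
  have h2 : 0 ≤ ∫ x, signedPow p (f x - -M) ∂μ :=
    integral_nonneg fun x => signedPow_nonneg (by have := (abs_le.1 (hfM x)).1; linarith)
  exact intermediate_value_Icc' (by linarith) hc ⟨h1, h2⟩

/-- One-dimensional weighted Poincaré inequality with sharp constant for log-concave weights. -/
lemma poincare_logConcave {p : ℝ} (hp : 2 ≤ p) {α β L : ℝ} (hαβ : α ≤ β) (hL : 0 < L)
    (hlen : (β - α) * L < piP p) {ρ : ℝ → ℝ} (hρ : Continuous ρ) (hpos : ∀ t, 0 < ρ t)
    (hlc : ConcaveOn ℝ (Set.Icc α β) fun t => Real.log (ρ t)) {G G' : ℝ → ℝ}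
    (hG : ∀ t, HasDerivAt G (G' t) t) (hG' : Continuous G') {M : ℝ} (hM : 0 ≤ M)
    (hGM : ∀ t, |G t| ≤ M) :
    ∃ c ∈ Set.Icc (-M) M, ∫ t in α..β, |G t - c| ^ p * ρ t
      ≤ (L ^ p)⁻¹ * ∫ t in α..β, |G' t| ^ p * ρ t := by
  set q := p / (p - 1) with hq
  have hpq : p.HolderConjugate q := Real.HolderConjugate.conjExponent (by linarith)
  have hp0 : 0 < p := by linarith
  have hq1 : 1 < q := hpq.symm.lt
  have hGc : Continuous G := continuous_iff_continuousAt.2 fun t => (hG t).continuousAt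
  set μ : Measure ℝ := (volume.restrict (Set.Ioc α β)).withDensity fun t => ENNReal.ofReal (ρ t)
  have hρi : IntegrableOn ρ (Set.Ioc α β) := (hρ.integrableOn_Icc).mono_set Set.Ioc_subset_Icc_self
  have : IsFiniteMeasure μ := isFiniteMeasure_withDensity_ofReal hρi.2
  obtain ⟨c, hcM, hc⟩ := exists_integral_signedPow_sub_eq_zero μ hp
    hGc.aestronglyMeasurable hM hGM
  refine ⟨c, hcM, ?_⟩
  set N' : ℝ → ℝ := fun t => signedPow p (G t - c) * ρ t with hN'def
  have hN'c : Continuous N' := ((continuous_signedPow hp).comp (hGc.sub continuous_const)).mul hρ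
  set N : ℝ → ℝ := fun t => ∫ s in α..t, N' s with hNdef
  have hN : ∀ t, HasDerivAt N (N' t) t := fun t => hN'c.integral_hasStrictDerivAt α t |>.hasDerivAt
  have hNα : N α = 0 := by simp [hNdef]
  have hNβ : N β = 0 := by
    rw [integral_withDensity_eq_integral_toReal_smul (by fun_prop)
      (Eventually.of_forall fun _ => ENNReal.ofReal_lt_top)] at hc
    rw [hNdef]
    simp only
    rw [intervalIntegral.integral_of_le hαβ, ← hc]
    refine integral_congr_ae (Eventually.of_forall fun t => ?_)
    simp only [hN'def, ENNReal.toReal_ofReal (hpos t).le, smul_eq_mul, mul_comm]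
  have hNc : Continuous N := continuous_iff_continuousAt.2 fun t => (hN t).continuousAt
  set V : ℝ → ℝ := fun t => -(q - 1) * Real.log (ρ t) with hVdef
  have hVc : Continuous V := continuous_const.mul (hρ.log fun t => (hpos t).ne')
  have hV : ConvexOn ℝ (Set.Icc α β) V := by
    have := (hlc.smul (by linarith : 0 ≤ q - 1)).neg
    refine this.congr fun t _ => ?_
    simp only [hVdef, Pi.neg_apply, smul_eq_mul]; ring
  have hexp : ∀ t, Real.exp (V t) = ρ t ^ (1 - q) := by
    intro t
    rw [Real.rpow_def_of_pos (hpos t), hVdef]; congr 1; ring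
  obtain ⟨R, hR, hdR⟩ := exists_barrier_length hpq hL hlen
  have key := dirichlet_logConvex hpq (Real.rpow_pos_of_pos hL q) hR hαβ hdR hN hN'c hNα hNβ hVc hV
  set X := ∫ t in α..β, |G t - c| ^ p * ρ t
  have hcontX : Continuous fun t => |G t - c| ^ p * ρ t :=
    (((hGc.sub continuous_const).abs).rpow_const fun _ => Or.inr hp0.le).mul hρ
  have hcontA : Continuous fun t => |G' t| ^ p * ρ t :=
    (hG'.abs.rpow_const fun _ => Or.inr hp0.le).mul hρ
  have hcontB : Continuous fun t => |N t| ^ q * Real.exp (V t) :=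
    (hNc.abs.rpow_const fun _ => Or.inr (by linarith)).mul (Real.continuous_exp.comp hVc)
  have hpm : (p - 1) * q = p := by rw [hq]; field_simp [show p - 1 ≠ 0 by linarith]
  have e1 : ∀ t, |N' t| ^ q * Real.exp (V t) = |G t - c| ^ p * ρ t := by
    intro t
    rw [hexp, hN'def]
    simp only
    rw [abs_mul, abs_signedPow hp, abs_of_pos (hpos t),
      Real.mul_rpow (Real.rpow_nonneg (abs_nonneg _) _) (hpos t).le,
      ← Real.rpow_mul (abs_nonneg _), hpm, mul_assoc, ← Real.rpow_add (hpos t)]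
    simp
  have key2 : L ^ q * ∫ t in α..β, |N t| ^ q * Real.exp (V t) ≤ X := by
    rw [← intervalIntegral.integral_const_mul, ← sub_nonneg,
      ← intervalIntegral.integral_sub (hcontX.intervalIntegrable _ _)
        ((hcontB.const_mul _).intervalIntegrable _ _)]
    refine key.trans_eq (intervalIntegral.integral_congr fun t _ => ?_)
    rw [← e1]; ring
  have hparts : X = -∫ t in α..β, G' t * N t := by
    have h := intervalIntegral.integral_mul_deriv_eq_deriv_mul (a := α) (b := β)
      (u := fun t => G t - c) (u' := G') (v := N) (v' := N')
      (fun t _ => (hG t).sub_const c) (fun t _ => hN t) (hG'.intervalIntegrable _ _)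
      (hN'c.intervalIntegrable _ _)
    rw [hNα, hNβ] at h
    simp only [mul_zero, sub_self, zero_sub] at h
    rw [← h]
    refine intervalIntegral.integral_congr fun t _ => ?_
    simp only [hN'def]
    rw [← signedPow_mul_self hp]; ring
  have hpt : ∀ t, -(G' t * N t) ≤ (L ^ p)⁻¹ / p * (|G' t| ^ p * ρ t)
      + L ^ q / q * (|N t| ^ q * Real.exp (V t)) := by
    intro t
    have hρt := hpos t
    have h := Real.young_inequality_of_nonneg
      (a := L⁻¹ * (|G' t| * ρ t ^ (1 / p))) (b := L * (|N t| * ρ t ^ (-(1 / p))))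
      (by positivity) (by positivity) hpq
    rw [Real.mul_rpow (by positivity) (by positivity), Real.mul_rpow (by positivity) (by positivity),
      Real.mul_rpow (by positivity) (by positivity), Real.mul_rpow (by positivity) (by positivity),
      ← Real.rpow_mul hρt.le, ← Real.rpow_mul hρt.le, Real.inv_rpow hL.le,
      show 1 / p * p = 1 by field_simp, Real.rpow_one,
      show -(1 / p) * q = 1 - q by
        rw [hq]; field_simp [show p - 1 ≠ 0 by linarith]; ring] at h
    rw [hexp]
    have h0 : ρ t ^ (1 / p) * ρ t ^ (-(1 / p)) = 1 := by
      rw [← Real.rpow_add hρt]; simp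
    have h1 : L⁻¹ * (|G' t| * ρ t ^ (1 / p)) * (L * (|N t| * ρ t ^ (-(1 / p))))
        = |G' t| * |N t| := by
      calc _ = (L⁻¹ * L) * (|G' t| * |N t|) * (ρ t ^ (1 / p) * ρ t ^ (-(1 / p))) := by ring
        _ = _ := by rw [h0, inv_mul_cancel₀ hL.ne']; ring
    rw [h1] at h
    calc -(G' t * N t) ≤ |G' t| * |N t| := by rw [← abs_mul]; exact neg_le_abs _
      _ ≤ _ := h
      _ = _ := by ring
  have hX : X ≤ (L ^ p)⁻¹ / p * (∫ t in α..β, |G' t| ^ p * ρ t)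
      + L ^ q / q * ∫ t in α..β, |N t| ^ q * Real.exp (V t) := by
    rw [hparts, ← intervalIntegral.integral_neg, ← intervalIntegral.integral_const_mul,
      ← intervalIntegral.integral_const_mul, ← intervalIntegral.integral_add
        ((hcontA.const_mul _).intervalIntegrable _ _)
        ((hcontB.const_mul _).intervalIntegrable _ _)]
    refine intervalIntegral.integral_mono_on hαβ ((show Continuous fun t => -(G' t * N t) from (hG'.mul hNc).neg).intervalIntegrable _ _)
      (((hcontA.const_mul _).add (hcontB.const_mul _)).intervalIntegrable _ _)
      fun t _ => hpt t
  have h6 : L ^ q / q * (∫ t in α..β, |N t| ^ q * Real.exp (V t)) ≤ X / q := by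
    rw [div_mul_eq_mul_div]; gcongr
  have h7 : X / q = X - X / p := by
    have := hpq.inv_add_inv_eq_one
    rw [div_eq_mul_inv, div_eq_mul_inv, show q⁻¹ = 1 - p⁻¹ by linarith]; ring
  have h8 : X / p ≤ (L ^ p)⁻¹ / p * (∫ t in α..β, |G' t| ^ p * ρ t) := by linarith
  rw [div_mul_eq_mul_div] at h8
  exact (div_le_div_iff_of_pos_right hp0).1 h8

lemma add_rpow_sub_one_mul_ge {p r s : ℝ} (hp : 2 ≤ p) (hr : 0 ≤ r) (hs : 0 ≤ s) :
    (2 : ℝ) ^ (2 - p) * (r + s) ^ p ≤ (r ^ (p - 1) + s ^ (p - 1)) * (r + s) := by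
  have h : (r + s) ^ (p - 1) ≤ 2 ^ (p - 1 - 1) * (r ^ (p - 1) + s ^ (p - 1)) := by
    have := NNReal.rpow_add_le_mul_rpow_add_rpow ⟨r, hr⟩ ⟨s, hs⟩ (by linarith : 1 ≤ p - 1)
    exact_mod_cast this
  have h2 : (r + s) ^ p = (r + s) ^ (p - 1) * (r + s) := by
    rw [← Real.rpow_add_one' (by positivity) (by linarith)]; congr 1; ring
  have h3 : (2 : ℝ) ^ (2 - p) * 2 ^ (p - 1 - 1) = 1 := by
    rw [← Real.rpow_add two_pos]; ring_nf; simp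
  calc (2 : ℝ) ^ (2 - p) * (r + s) ^ p = (2 : ℝ) ^ (2 - p) * ((r + s) ^ (p - 1) * (r + s)) := by
        rw [h2]
    _ ≤ (2 : ℝ) ^ (2 - p) * (2 ^ (p - 1 - 1) * (r ^ (p - 1) + s ^ (p - 1)) * (r + s)) := by
        gcongr
    _ = ((2 : ℝ) ^ (2 - p) * 2 ^ (p - 1 - 1)) * ((r ^ (p - 1) + s ^ (p - 1)) * (r + s)) := by ring
    _ = _ := by rw [h3, one_mul]

lemma abs_sub_rpow_le {p r s : ℝ} (hp : 2 ≤ p) (hr : 0 ≤ r) (hs : 0 ≤ s) :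
    |r - s| ^ p ≤ (r ^ (p - 1) - s ^ (p - 1)) * (r - s) := by
  wlog h : s ≤ r generalizing r s
  · have := this hs hr (le_of_not_ge h)
    rw [abs_sub_comm]; linarith
  have h1 := Real.add_rpow_le_rpow_add (sub_nonneg.2 h) hs (by linarith : 1 ≤ p - 1)
  rw [sub_add_cancel] at h1
  rw [abs_of_nonneg (sub_nonneg.2 h),
    show (r - s) ^ p = (r - s) ^ (p - 1) * (r - s) by
      rw [← Real.rpow_add_one' (sub_nonneg.2 h) (by linarith)]; congr 1; ring]
  exact mul_le_mul_of_nonneg_right (by linarith) (sub_nonneg.2 h)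

section

variable {E : Type*} [NormedAddCommGroup E] [InnerProductSpace ℝ E]

/-- Strong monotonicity of the duality map `x ↦ ‖x‖^{p-2} x`. -/
lemma inner_norm_rpow_sub_ge {p : ℝ} (hp : 2 ≤ p) (x y : E) :
    (2 : ℝ) ^ (2 - p) * ‖x - y‖ ^ p
      ≤ ‖x‖ ^ (p - 2) * ⟪x, x - y⟫ - ‖y‖ ^ (p - 2) * ⟪y, x - y⟫ := by
  set r := ‖x‖ with hr
  set s := ‖y‖ with hs
  set c := ⟪x, y⟫ with hc
  have hr0 : 0 ≤ r := norm_nonneg x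
  have hs0 : 0 ≤ s := norm_nonneg y
  have hcs : |c| ≤ r * s := abs_real_inner_le_norm x y
  obtain ⟨θ, hθ0, hθ1, hθ⟩ : ∃ θ : ℝ, 0 ≤ θ ∧ θ ≤ 1 ∧ c = (1 - θ) * (-(r * s)) + θ * (r * s) := by
    rcases (mul_nonneg hr0 hs0).eq_or_lt with h | h
    · refine ⟨1 / 2, by norm_num, by norm_num, ?_⟩
      rw [← h] at hcs ⊢
      simpa using hcs
    · have := abs_le.1 hcs
      refine ⟨(c + r * s) / (2 * (r * s)), div_nonneg (by linarith) (by positivity),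
        (div_le_one (by positivity)).2 (by linarith), ?_⟩
      have h0 := h.ne'
      generalize r * s = z at *
      field_simp; ring
  have hpow1 : ∀ z : ℝ, 0 ≤ z → z ^ (p - 1) = z ^ (p - 2) * z := by
    intro z hz
    rw [← Real.rpow_add_one' hz (by linarith)]; congr 1; ring
  have hsq : ∀ z : ℝ, (z ^ 2) ^ (p / 2) = |z| ^ p := by
    intro z
    rw [← sq_abs, ← Real.rpow_two, ← Real.rpow_mul (abs_nonneg z)]; congr 1; ring
  have hnorm : ‖x - y‖ ^ p = (r ^ 2 - 2 * c + s ^ 2) ^ (p / 2) := by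
    rw [← norm_sub_sq_real, hsq, abs_norm]
  have hmix : r ^ 2 - 2 * c + s ^ 2 = (1 - θ) * (r + s) ^ 2 + θ * (r - s) ^ 2 := by
    rw [hθ]; ring
  have hconv := (convexOn_rpow (by linarith : 1 ≤ p / 2)).2 (sq_nonneg (r + s))
    (sq_nonneg (r - s)) (by linarith : 0 ≤ 1 - θ) hθ0 (by ring)
  simp only [smul_eq_mul] at hconv
  rw [← hmix, ← hnorm, hsq, hsq, abs_of_nonneg (add_nonneg hr0 hs0)] at hconv
  have hA := add_rpow_sub_one_mul_ge hp hr0 hs0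
  have hB := abs_sub_rpow_le hp hr0 hs0
  have h2 : (2 : ℝ) ^ (2 - p) ≤ 1 :=
    Real.rpow_le_one_of_one_le_of_nonpos one_le_two (by linarith)
  have h2' : (0 : ℝ) ≤ (2 : ℝ) ^ (2 - p) := by positivity
  have hB' : (2 : ℝ) ^ (2 - p) * |r - s| ^ p ≤ (r ^ (p - 1) - s ^ (p - 1)) * (r - s) :=
    (mul_le_of_le_one_left (by positivity) h2).trans hB
  have hl : r ^ (p - 2) * ⟪x, x - y⟫ - s ^ (p - 2) * ⟪y, x - y⟫
      = (1 - θ) * ((r ^ (p - 1) + s ^ (p - 1)) * (r + s))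
        + θ * ((r ^ (p - 1) - s ^ (p - 1)) * (r - s)) := by
    rw [inner_sub_right, inner_sub_right, real_inner_self_eq_norm_sq, real_inner_self_eq_norm_sq,
      real_inner_comm x y, ← hc, ← hr, ← hs, hpow1 r hr0, hpow1 s hs0, hθ]
    ring
  rw [hl]
  calc (2 : ℝ) ^ (2 - p) * ‖x - y‖ ^ p
      ≤ (2 : ℝ) ^ (2 - p) * ((1 - θ) * (r + s) ^ p + θ * |r - s| ^ p) :=
        mul_le_mul_of_nonneg_left hconv h2'
    _ = (1 - θ) * ((2 : ℝ) ^ (2 - p) * (r + s) ^ p) + θ * ((2 : ℝ) ^ (2 - p) * |r - s| ^ p) := by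
        ring
    _ ≤ _ := add_le_add (mul_le_mul_of_nonneg_left hA (by linarith))
        (mul_le_mul_of_nonneg_left hB' hθ0)

/-- Uniform convexity of `‖·‖^p`, with remainder `2^{2-p} ‖b‖^p`. -/
lemma norm_add_rpow_ge {p : ℝ} (hp : 2 ≤ p) (a b : E) :
    ‖a‖ ^ p + p * (‖a‖ ^ (p - 2) * ⟪a, b⟫) + (2 : ℝ) ^ (2 - p) * ‖b‖ ^ p ≤ ‖a + b‖ ^ p := by
  set h : ℝ → ℝ := fun t => ‖a + t • b‖ ^ p - t * (p * (‖a‖ ^ (p - 2) * ⟪a, b⟫))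
    - t ^ p * ((2 : ℝ) ^ (2 - p) * ‖b‖ ^ p) with hh
  have hd : ∀ t, HasDerivAt h (p * ‖a + t • b‖ ^ (p - 2) * ⟪a + t • b, b⟫
      - 1 * (p * (‖a‖ ^ (p - 2) * ⟪a, b⟫))
      - p * t ^ (p - 1) * ((2 : ℝ) ^ (2 - p) * ‖b‖ ^ p)) t := by
    intro t
    have h1 : HasDerivAt (fun t : ℝ => a + t • b) b t := by
      simpa using ((hasDerivAt_id t).smul_const b).const_add a
    have h2 := (hasFDerivAt_norm_rpow (a + t • b) (by linarith : 1 < p)).comp_hasDerivAt t h1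
    have h3 : HasDerivAt (fun t : ℝ => t ^ p) (p * t ^ (p - 1)) t :=
      Real.hasDerivAt_rpow_const (Or.inr (by linarith))
    exact (h2.sub ((hasDerivAt_id t).mul_const _)).sub (h3.mul_const _)
  have hmono : MonotoneOn h (Set.Icc 0 1) := by
    refine monotoneOn_of_deriv_nonneg (convex_Icc 0 1)
      (fun t _ => (hd t).continuousAt.continuousWithinAt)
      (fun t _ => (hd t).differentiableAt.differentiableWithinAt) fun t ht => ?_
    rw [interior_Icc] at ht
    rw [(hd t).deriv]
    have hm := inner_norm_rpow_sub_ge hp (a + t • b) a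
    have ht0 : 0 < t := ht.1
    rw [add_sub_cancel_left, inner_smul_right, inner_smul_right, norm_smul, Real.norm_eq_abs,
      abs_of_pos ht0, Real.mul_rpow ht0.le (norm_nonneg b)] at hm
    have e : t ^ p = t * t ^ (p - 1) := by
      rw [mul_comm, ← Real.rpow_add_one ht0.ne']; congr 1; ring
    rw [e] at hm
    refine nonneg_of_mul_nonneg_right (a := t) ?_ ht0
    have hp0 : 0 < p := by linarith
    nlinarith [mul_le_mul_of_nonneg_left hm hp0.le]
  have := hmono (Set.left_mem_Icc.2 zero_le_one) (Set.right_mem_Icc.2 zero_le_one) zero_le_one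
  simp only [hh, zero_smul, add_zero, zero_mul, sub_zero, one_smul, one_mul, Real.one_rpow,
    Real.zero_rpow (by linarith : p ≠ 0)] at this
  linarith

end

section

variable {E : Type*} [NormedAddCommGroup E] [InnerProductSpace ℝ E] [FiniteDimensional ℝ E]

lemma norm_gradient_sub_gradient (f g : E → ℝ) (x : E) :
    ‖gradient f x - gradient g x‖ = ‖fderiv ℝ f x - fderiv ℝ g x‖ := by
  rw [gradient, gradient, ← map_sub, LinearIsometryEquiv.norm_map]

lemma tsupport_gradient_subset (f : E → ℝ) : tsupport (gradient f) ⊆ tsupport f := by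
  refine closure_minimal (fun x hx => ?_) (isClosed_tsupport f)
  refine support_fderiv_subset ℝ (f := f) ?_
  intro h
  exact hx (by rw [gradient, h, map_zero])

lemma continuous_gradient {f : E → ℝ} (hf : ContDiff ℝ 1 f) : Continuous (gradient f) :=
  (LinearIsometryEquiv.continuous _).comp (hf.continuous_fderiv one_ne_zero)

variable [MeasurableSpace E] [BorelSpace E]

/-- A compactly supported `C¹` function is approximated in `C¹` norm by smooth functions supported
in a small neighbourhood of its support. -/
lemma exists_contDiff_approx {ψ : E → ℝ} (hψ : ContDiff ℝ 1 ψ) (hc : HasCompactSupport ψ)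
    {δ ε : ℝ} (hδ : 0 < δ) (hε : 0 < ε) :
    ∃ φ : E → ℝ, ContDiff ℝ (⊤ : ℕ∞) φ ∧ tsupport φ ⊆ Metric.cthickening δ (tsupport ψ) ∧
      (∀ x, |φ x - ψ x| ≤ ε) ∧ ∀ x, ‖gradient φ x - gradient ψ x‖ ≤ ε := by
  have hcont := hψ.continuous
  have hcontd := hψ.continuous_fderiv one_ne_zero
  obtain ⟨η₁, hη₁, h1⟩ := Metric.uniformContinuous_iff.1
    (hc.uniformContinuous_of_continuous hcont) ε hε
  obtain ⟨η₂, hη₂, h2⟩ := Metric.uniformContinuous_iff.1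
    ((hc.fderiv ℝ).uniformContinuous_of_continuous hcontd) ε hε
  set r := min δ (min η₁ η₂)
  have hr : 0 < r := lt_min hδ (lt_min hη₁ hη₂)
  let B : ContDiffBump (0 : E) := ⟨r / 2, r, by positivity, by linarith⟩
  set φ := convolution (B.normed volume) ψ (ContinuousLinearMap.lsmul ℝ ℝ) volume with hφ
  have hBint : LocallyIntegrable (B.normed volume) (volume : Measure E) :=
    (B.contDiff_normed (n := 0)).continuous.locallyIntegrable
  have hd : ∀ x, HasFDerivAt φ (convolution (B.normed volume) (fderiv ℝ ψ)
      (ContinuousLinearMap.lsmul ℝ ℝ) volume x) x := by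
    intro x
    have := hc.hasFDerivAt_convolution_right (ContinuousLinearMap.lsmul ℝ ℝ) hBint hψ x
    refine this.congr_fderiv ?_
    refine integral_congr_ae (Eventually.of_forall fun t => ?_)
    ext v
    simp
  refine ⟨φ, B.hasCompactSupport_normed.contDiff_convolution_left _ B.contDiff_normed
    hcont.locallyIntegrable, ?_, ?_, ?_⟩
  · refine closure_minimal ?_ Metric.isClosed_cthickening
    refine (support_convolution_subset _).trans ?_
    rintro _ ⟨a, ha, b, hb, rfl⟩
    rw [B.support_normed_eq, Metric.mem_ball, dist_zero_right] at ha
    refine Metric.mem_cthickening_of_dist_le (a + b) b δ _ (subset_tsupport _ hb) ?_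
    rw [dist_eq_norm, add_sub_cancel_right]
    exact ha.le.trans (min_le_left _ _)
  · intro x
    refine B.dist_normed_convolution_le hcont.aestronglyMeasurable fun y hy => (h1 ?_).le
    exact lt_of_lt_of_le (Metric.mem_ball.1 hy) ((min_le_right _ _).trans (min_le_left _ _))
  · intro x
    rw [norm_gradient_sub_gradient, (hd x).fderiv, ← dist_eq_norm]
    refine B.dist_normed_convolution_le hcontd.aestronglyMeasurable fun y hy => (h2 ?_).le
    exact lt_of_lt_of_le (Metric.mem_ball.1 hy) ((min_le_right _ _).trans (min_le_right _ _))

lemma integrableOn_of_continuousOn_of_eq_zero {F : Type*} [NormedAddCommGroup F] {Ω K : Set E}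
    (hΩ : IsOpen Ω) (hK : IsCompact K) (hKΩ : K ⊆ Ω) {g : E → F} (hg : ContinuousOn g Ω)
    (h0 : ∀ x ∈ Ω, x ∉ K → g x = 0) : IntegrableOn g Ω := by
  have h1 : IntegrableOn g K := (hg.mono hKΩ).integrableOn_compact hK
  have h2 : IntegrableOn (K.indicator g) Ω :=
    ((integrable_indicator_iff hK.measurableSet).2 h1).integrableOn
  refine h2.congr_fun (fun x hx => ?_) hΩ.measurableSet
  by_cases hxK : x ∈ K
  · simp [hxK]
  · simp [hxK, h0 x hx hxK]

/-- A weak identity tested against smooth functions extends to `C¹` test functions. -/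
lemma weak_identity_of_contDiff_one {Ω : Set E} (hΩ : IsOpen Ω) {F : E → E} {h : E → ℝ}
    (hF : ContinuousOn F Ω) (hh : ContinuousOn h Ω) {lam : ℝ}
    (hweak : ∀ φ : E → ℝ, ContDiff ℝ (⊤ : ℕ∞) φ → HasCompactSupport φ → tsupport φ ⊆ Ω →
      ∫ x in Ω, ⟪F x, gradient φ x⟫ = lam * ∫ x in Ω, h x * φ x)
    {ψ : E → ℝ} (hψ : ContDiff ℝ 1 ψ) (hc : HasCompactSupport ψ) (hs : tsupport ψ ⊆ Ω) :
    ∫ x in Ω, ⟪F x, gradient ψ x⟫ = lam * ∫ x in Ω, h x * ψ x := by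
  obtain ⟨δ, hδ, hδΩ⟩ := hc.isCompact.exists_cthickening_subset_open hΩ hs
  set K := Metric.cthickening δ (tsupport ψ)
  have hK : IsCompact K := hc.isCompact.cthickening
  choose φ hφ1 hφ2 hφ3 hφ4 using fun k : ℕ =>
    exists_contDiff_approx hψ hc hδ (Nat.one_div_pos_of_nat (α := ℝ) (n := k))
  have hφK : ∀ k x, x ∉ K → φ k x = 0 := fun k x hx =>
    image_eq_zero_of_notMem_tsupport fun h' => hx (hφ2 k h')
  have hgφK : ∀ k x, x ∉ K → gradient (φ k) x = 0 := fun k x hx =>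
    image_eq_zero_of_notMem_tsupport fun h' => hx (hφ2 k (tsupport_gradient_subset _ h'))
  have hψK : ∀ x, x ∉ K → ψ x = 0 := fun x hx =>
    image_eq_zero_of_notMem_tsupport fun h' => hx (Metric.self_subset_cthickening _ h')
  have hgψK : ∀ x, x ∉ K → gradient ψ x = 0 := fun x hx =>
    image_eq_zero_of_notMem_tsupport fun h' =>
      hx (Metric.self_subset_cthickening _ (tsupport_gradient_subset _ h'))
  have hφc : ∀ k, HasCompactSupport (φ k) := fun k =>
    HasCompactSupport.of_support_subset_isCompact hK ((subset_tsupport _).trans (hφ2 k))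
  have hgc : ∀ k, Continuous (gradient (φ k)) := fun k =>
    continuous_gradient ((hφ1 k).of_le (by exact_mod_cast le_top))
  have lim0 : Tendsto (fun k : ℕ => 1 / ((k : ℝ) + 1)) atTop (nhds 0) :=
    tendsto_one_div_add_atTop_nhds_zero_nat
  have le1 : ∀ k : ℕ, 1 / ((k : ℝ) + 1) ≤ 1 := fun k => by
    rw [div_le_one (by positivity)]; linarith [(Nat.cast_nonneg k : (0 : ℝ) ≤ k)]
  have L1 : Tendsto (fun k => ∫ x in Ω, ⟪F x, gradient (φ k) x⟫) atTop
      (nhds (∫ x in Ω, ⟪F x, gradient ψ x⟫)) := by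
    refine tendsto_integral_of_dominated_convergence
      (K.indicator fun x => ‖F x‖ * (‖gradient ψ x‖ + 1)) (fun k => ?_) ?_ (fun k => ?_) ?_
    · exact (hF.inner (𝕜 := ℝ) (hgc k).continuousOn).aestronglyMeasurable hΩ.measurableSet
    · refine ((integrable_indicator_iff hK.measurableSet).2 ?_).integrableOn
      exact ((hF.mono hδΩ).norm.mul ((continuous_gradient hψ).norm.add
        continuous_const).continuousOn).integrableOn_compact hK
    · refine Eventually.of_forall fun x => ?_
      by_cases hx : x ∈ K
      · rw [Set.indicator_of_mem hx]
        refine (norm_inner_le_norm _ _).trans (mul_le_mul_of_nonneg_left ?_ (norm_nonneg _))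
        have := norm_sub_norm_le (gradient (φ k) x) (gradient ψ x)
        linarith [hφ4 k x, le1 k]
      · simp [hx, hgφK k x hx]
    · refine Eventually.of_forall fun x => ?_
      refine Tendsto.inner tendsto_const_nhds ?_
      exact tendsto_iff_norm_sub_tendsto_zero.2
        (squeeze_zero (fun _ => norm_nonneg _) (fun k => hφ4 k x) lim0)
  have L2 : Tendsto (fun k => ∫ x in Ω, h x * φ k x) atTop (nhds (∫ x in Ω, h x * ψ x)) := by
    refine tendsto_integral_of_dominated_convergence
      (K.indicator fun x => |h x| * (|ψ x| + 1)) (fun k => ?_) ?_ (fun k => ?_) ?_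
    · exact (hh.mul (hφ1 k).continuous.continuousOn).aestronglyMeasurable hΩ.measurableSet
    · refine ((integrable_indicator_iff hK.measurableSet).2 ?_).integrableOn
      exact ((hh.mono hδΩ).abs.mul (hψ.continuous.abs.add
        continuous_const).continuousOn).integrableOn_compact hK
    · refine Eventually.of_forall fun x => ?_
      by_cases hx : x ∈ K
      · rw [Set.indicator_of_mem hx, Real.norm_eq_abs, abs_mul]
        refine mul_le_mul_of_nonneg_left ?_ (abs_nonneg _)
        have := abs_sub_abs_le_abs_sub (φ k x) (ψ x)
        linarith [hφ3 k x, le1 k]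
      · simp [hx, hφK k x hx]
    · refine Eventually.of_forall fun x => ?_
      refine Tendsto.mul tendsto_const_nhds ?_
      exact tendsto_iff_norm_sub_tendsto_zero.2
        (squeeze_zero (fun _ => norm_nonneg _) (fun k => hφ3 k x) lim0)
  refine tendsto_nhds_unique L1 ((L2.const_mul lam).congr fun k => ?_)
  exact (hweak (φ k) (hφ1 k) (hφc k) ((hφ2 k).trans hδΩ)).symm

end

lemma contDiff_one_of_eq_zero {E : Type*} [NormedAddCommGroup E] [NormedSpace ℝ E]
    {Ω : Set E} (hΩ : IsOpen Ω) {K : Set E} (hK : IsClosed K)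
    (hKΩ : K ⊆ Ω) {g : E → ℝ} (hg : ContDiffOn ℝ 1 g Ω) (h0 : ∀ x, x ∉ K → g x = 0) :
    ContDiff ℝ 1 g := by
  refine contDiff_iff_contDiffAt.2 fun x => ?_
  by_cases hx : x ∈ Ω
  · exact (hg x hx).contDiffAt (hΩ.mem_nhds hx)
  · refine (contDiffAt_const (c := (0 : ℝ))).congr_of_eventuallyEq ?_
    filter_upwards [hK.isOpen_compl.mem_nhds fun h => hx (hKΩ h)] with y hy
    exact h0 y hy

section

variable {E : Type*} [NormedAddCommGroup E] [InnerProductSpace ℝ E] [FiniteDimensional ℝ E]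

lemma continuousOn_gradient {Ω : Set E} (hΩ : IsOpen Ω) {u : E → ℝ} (hu : ContDiffOn ℝ 1 u Ω) :
    ContinuousOn (gradient u) Ω :=
  (LinearIsometryEquiv.continuous _).comp_continuousOn
    (hu.continuousOn_fderiv_of_isOpen hΩ le_rfl)

lemma gradient_mul {f g : E → ℝ} {x : E} (hf : DifferentiableAt ℝ f x)
    (hg : DifferentiableAt ℝ g x) :
    gradient (fun y => f y * g y) x = f x • gradient g x + g x • gradient f x := by
  rw [gradient, fderiv_fun_mul hf hg]
  simp [gradient]

variable [MeasurableSpace E] [BorelSpace E]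

/-- Picone-type stability inequality for the `p`-Laplacian. -/
lemma picone {p : ℝ} (hp : 2 ≤ p) {Ω : Set E} (hΩ : IsOpen Ω) {u : E → ℝ}
    (hu : ContDiffOn ℝ 1 u Ω) (hpos : ∀ x ∈ Ω, 0 < u x) {lam : ℝ}
    (hweak : ∀ φ : E → ℝ, ContDiff ℝ (⊤ : ℕ∞) φ → HasCompactSupport φ → tsupport φ ⊆ Ω →
      ∫ x in Ω, ‖gradient u x‖ ^ (p - 2) * ⟪gradient u x, gradient φ x⟫
        = lam * ∫ x in Ω, |u x| ^ (p - 2) * u x * φ x)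
    {φ : E → ℝ} (hφ : ContDiff ℝ (⊤ : ℕ∞) φ) (hc : HasCompactSupport φ) (hs : tsupport φ ⊆ Ω) :
    ∃ f : E → ℝ, ContDiff ℝ 1 f ∧ HasCompactSupport f ∧ tsupport f ⊆ Ω ∧
      (∀ x ∈ Ω, φ x = f x * u x) ∧
      (2 : ℝ) ^ (2 - p) * ∫ x in Ω, ‖gradient f x‖ ^ p * u x ^ p
        ≤ (∫ x in Ω, ‖gradient φ x‖ ^ p) - lam * ∫ x in Ω, |φ x| ^ p := by
  have hp0 : p ≠ 0 := by linarith
  have hp2 : 0 ≤ p - 2 := by linarith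
  set K := tsupport φ
  have hKc : IsCompact K := hc
  have hφ1 : ContDiff ℝ 1 φ := hφ.of_le (by exact_mod_cast le_top)
  have hφ0 : ∀ x, x ∉ K → φ x = 0 := fun x hx => image_eq_zero_of_notMem_tsupport hx
  set f : E → ℝ := fun x => φ x / u x with hf
  have hf0 : ∀ x, x ∉ K → f x = 0 := fun x hx => by simp [hf, hφ0 x hx]
  have hf1 : ContDiff ℝ 1 f := contDiff_one_of_eq_zero hΩ (isClosed_tsupport φ) hs
    (hφ1.contDiffOn.div hu fun x hx => (hpos x hx).ne') hf0
  have hfs : tsupport f ⊆ K := closure_minimal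
    (fun x hx => by_contra fun h => hx (hf0 x h)) (isClosed_tsupport φ)
  have hfφ : ∀ x ∈ Ω, φ x = f x * u x := fun x hx => (div_mul_cancel₀ _ (hpos x hx).ne').symm
  have hfp : ContDiff ℝ 1 fun x => |f x| ^ p := hf1.norm_rpow (by linarith)
  set ψ : E → ℝ := fun x => |f x| ^ p * u x with hψ
  have hψ0 : ∀ x, x ∉ K → ψ x = 0 := fun x hx => by simp [hψ, hf0 x hx, Real.zero_rpow hp0]
  have hψ1 : ContDiff ℝ 1 ψ := contDiff_one_of_eq_zero hΩ (isClosed_tsupport φ) hs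
    (hfp.contDiffOn.mul hu) hψ0
  have hψs : tsupport ψ ⊆ K := closure_minimal
    (fun x hx => by_contra fun h => hx (hψ0 x h)) (isClosed_tsupport φ)
  have hgu := continuousOn_gradient hΩ hu
  have hud : ∀ x ∈ Ω, DifferentiableAt ℝ u x := fun x hx =>
    ((hu x hx).contDiffAt (hΩ.mem_nhds hx)).differentiableAt one_ne_zero
  have hfd : Differentiable ℝ f := hf1.differentiable one_ne_zero
  have hweak' := weak_identity_of_contDiff_one hΩ (F := fun x => ‖gradient u x‖ ^ (p - 2) • gradient u x)
    (h := fun x => |u x| ^ (p - 2) * u x) (lam := lam)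
    ((hgu.norm.rpow_const fun x _ => Or.inr hp2).smul hgu)
    ((hu.continuousOn.abs.rpow_const fun x _ => Or.inr hp2).mul hu.continuousOn)
    (fun φ h1 h2 h3 => by simpa only [real_inner_smul_left] using hweak φ h1 h2 h3)
    hψ1 (HasCompactSupport.of_support_subset_isCompact hKc ((subset_tsupport _).trans hψs))
    (hψs.trans hs)
  simp only [real_inner_smul_left] at hweak'
  have hgφ : ∀ x ∈ Ω, gradient φ x = f x • gradient u x + u x • gradient f x := by
    intro x hx
    rw [← gradient_mul (hfd x) (hud x hx), gradient, gradient]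
    congr 1
    refine Filter.EventuallyEq.fderiv_eq ?_
    filter_upwards [hΩ.mem_nhds hx] with y hy using hfφ y hy
  have hgψ : ∀ x ∈ Ω, gradient ψ x
      = |f x| ^ p • gradient u x + u x • ((p * |f x| ^ (p - 2) * f x) • gradient f x) := by
    intro x hx
    rw [hψ, gradient_mul (hfp.differentiable one_ne_zero x) (hud x hx)]
    congr 2
    have := (hasDerivAt_abs_rpow (f x) (by linarith : 1 < p)).comp_hasFDerivAt x
      (hfd x).hasFDerivAt
    rw [gradient, show fderiv ℝ (fun y => |f y| ^ p) x = _ from this.fderiv, map_smul, gradient]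
  have hpt : ∀ x ∈ Ω, ‖gradient u x‖ ^ (p - 2) * ⟪gradient u x, gradient ψ x⟫
      + (2 : ℝ) ^ (2 - p) * (‖gradient f x‖ ^ p * u x ^ p) ≤ ‖gradient φ x‖ ^ p := by
    intro x hx
    have h := norm_add_rpow_ge hp (f x • gradient u x) (u x • gradient f x)
    rw [← hgφ x hx] at h
    refine le_trans (le_of_eq ?_) h
    rw [hgψ x hx]
    have hux := hpos x hx
    simp only [inner_add_right, real_inner_smul_left, real_inner_smul_right, norm_smul,
      Real.norm_eq_abs, real_inner_self_eq_norm_sq]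
    rw [Real.mul_rpow (abs_nonneg _) (norm_nonneg _), Real.mul_rpow (abs_nonneg _) (norm_nonneg _),
      Real.mul_rpow (abs_nonneg _) (norm_nonneg _), abs_of_pos hux]
    have e : ‖gradient u x‖ ^ p = ‖gradient u x‖ ^ (p - 2) * ‖gradient u x‖ ^ 2 := by
      rw [← Real.rpow_two, ← Real.rpow_add' (norm_nonneg _) (by linarith)]; congr 1; ring
    rw [e]; ring
  have hgf := continuous_gradient hf1
  have hgf0 : ∀ x, x ∉ K → gradient f x = 0 := fun x hx =>
    image_eq_zero_of_notMem_tsupport fun h' => hx (hfs (tsupport_gradient_subset _ h'))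
  have hgφ0 : ∀ x, x ∉ K → gradient φ x = 0 := fun x hx =>
    image_eq_zero_of_notMem_tsupport fun h' => hx (tsupport_gradient_subset _ h')
  have hgψ0 : ∀ x, x ∉ K → gradient ψ x = 0 := fun x hx =>
    image_eq_zero_of_notMem_tsupport fun h' => hx (hψs (tsupport_gradient_subset _ h'))
  have I1 : IntegrableOn (fun x => ‖gradient u x‖ ^ (p - 2) * ⟪gradient u x, gradient ψ x⟫) Ω :=
    integrableOn_of_continuousOn_of_eq_zero hΩ hKc hs
      ((hgu.norm.rpow_const fun x _ => Or.inr hp2).mul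
        (hgu.inner (𝕜 := ℝ) (continuous_gradient hψ1).continuousOn))
      fun x _ hx => by simp [hgψ0 x hx]
  have I2 : IntegrableOn (fun x => ‖gradient f x‖ ^ p * u x ^ p) Ω :=
    integrableOn_of_continuousOn_of_eq_zero hΩ hKc hs
      ((hgf.norm.continuousOn.rpow_const fun x _ => Or.inr (by linarith)).mul
        (hu.continuousOn.rpow_const fun x _ => Or.inr (by linarith)))
      fun x _ hx => by simp [hgf0 x hx, Real.zero_rpow hp0]
  have I3 : IntegrableOn (fun x => ‖gradient φ x‖ ^ p) Ω :=
    integrableOn_of_continuousOn_of_eq_zero hΩ hKc hs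
      ((continuous_gradient hφ1).norm.continuousOn.rpow_const fun x _ => Or.inr (by linarith))
      fun x _ hx => by simp [hgφ0 x hx, Real.zero_rpow hp0]
  refine ⟨f, hf1, HasCompactSupport.of_support_subset_isCompact hKc
    ((subset_tsupport _).trans hfs), hfs.trans hs, hfφ, ?_⟩
  have hmono := setIntegral_mono_on (I1.add (I2.const_mul ((2 : ℝ) ^ (2 - p)))) I3
    hΩ.measurableSet hpt
  rw [integral_add' I1 (I2.const_mul ((2 : ℝ) ^ (2 - p))), integral_const_mul, hweak'] at hmono
  have e3 : ∫ x in Ω, |u x| ^ (p - 2) * u x * ψ x = ∫ x in Ω, |φ x| ^ p := by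
    refine setIntegral_congr_fun hΩ.measurableSet fun x hx => ?_
    have hux := hpos x hx
    simp only [hψ]
    rw [hfφ x hx, abs_mul, Real.mul_rpow (abs_nonneg _) (abs_nonneg _), abs_of_pos hux]
    have e : u x ^ p = u x ^ (p - 2) * u x ^ 2 := by
      rw [← Real.rpow_two, ← Real.rpow_add hux]; congr 1; ring
    rw [e]; ring
  rw [e3] at hmono
  linarith

end

/-- The one-dimensional Brunn–Minkowski inequality for compact sets. -/
lemma volume_add_le_of_isCompact {A B C : Set ℝ} (hA : IsCompact A) (hB : IsCompact B)
    (hAn : A.Nonempty) (hBn : B.Nonempty) (hC : ∀ a ∈ A, ∀ b ∈ B, a + b ∈ C) :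
    volume A + volume B ≤ volume C := by
  obtain ⟨a, ha, hamax⟩ := hA.exists_isGreatest hAn
  obtain ⟨b, hb, hbmin⟩ := hB.exists_isLeast hBn
  have h1 : volume ((fun x => x + b) '' A ∪ (fun x => a + x) '' B) = volume A + volume B := by
    rw [measure_union₀' (((hA.image (by fun_prop)).measurableSet).nullMeasurableSet)]
    · congr 1
      · simp [Set.image_add_right]
      · simp [Set.image_add_left]
    · refine measure_mono_null (t := {a + b}) ?_ (by simp)
      rintro x ⟨⟨y, hy, rfl⟩, ⟨z, hz, hz'⟩⟩
      have := hamax hy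
      have := hbmin hz
      simp only at hz'
      simp only [Set.mem_singleton_iff]
      linarith
  rw [← h1]
  refine measure_mono ?_
  rintro x (⟨y, hy, rfl⟩ | ⟨y, hy, rfl⟩)
  · exact hC y hy b hb
  · exact hC a ha y hy

lemma volume_add_le {A B C : Set ℝ} (hA : MeasurableSet A) (hB : MeasurableSet B)
    (hAn : A.Nonempty) (hBn : B.Nonempty) (hC : ∀ a ∈ A, ∀ b ∈ B, a + b ∈ C) :
    volume A + volume B ≤ volume C := by
  obtain ⟨a, ha⟩ := hAn
  obtain ⟨b, hb⟩ := hBn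
  have key : ∀ K ⊆ A, IsCompact K → ∀ K' ⊆ B, IsCompact K' →
      volume K + volume K' ≤ volume C := by
    intro K hKA hK K' hKB hK'
    refine le_trans (add_le_add (measure_mono (Set.subset_insert a K))
      (measure_mono (Set.subset_insert b K'))) ?_
    refine volume_add_le_of_isCompact (hK.insert a) (hK'.insert b) (Set.insert_nonempty _ _)
      (Set.insert_nonempty _ _) fun x hx y hy => hC x ?_ y ?_
    · exact Set.insert_subset ha hKA hx
    · exact Set.insert_subset hb hKB hy
  have key2 : ∀ K' ⊆ B, IsCompact K' → volume A + volume K' ≤ volume C := by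
    intro K' hKB hK'
    refine (ENNReal.le_sub_iff_add_le_right hK'.measure_ne_top ?_).1 ?_
    · exact le_trans (by simp) (key ∅ (by simp) isCompact_empty K' hKB hK')
    · rw [hA.measure_eq_iSup_isCompact]
      refine iSup₂_le fun K hKA => iSup_le fun hK => ?_
      exact ENNReal.le_sub_of_add_le_right hK'.measure_ne_top (key K hKA hK K' hKB hK')
  have hAC : volume A ≤ volume C := le_trans (by simp) (key2 ∅ (by simp) isCompact_empty)
  rcases eq_or_ne (volume A) ⊤ with h | h
  · rw [h, top_le_iff] at hAC
    rw [hAC]; exact le_top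
  · refine (ENNReal.le_sub_iff_add_le_left h hAC).1 ?_
    rw [hB.measure_eq_iSup_isCompact]
    refine iSup₂_le fun K' hKB => iSup_le fun hK' => ?_
    exact ENNReal.le_sub_of_add_le_left h (key2 K' hKB hK')

open scoped Pointwise in
lemma volume_convexComb_le {A B C : Set ℝ} (hA : MeasurableSet A) (hB : MeasurableSet B)
    (hAn : A.Nonempty) (hBn : B.Nonempty) {s t : ℝ} (hs : 0 < s) (ht : 0 < t)
    (hC : ∀ a ∈ A, ∀ b ∈ B, s * a + t * b ∈ C) :
    ENNReal.ofReal s * volume A + ENNReal.ofReal t * volume B ≤ volume C := by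
  have h := volume_add_le (A := s • A) (B := t • B) (C := C) (hA.const_smul₀ s) (hB.const_smul₀ t)
    hAn.smul_set hBn.smul_set ?_
  · simpa [Measure.addHaar_smul, abs_of_pos hs, abs_of_pos ht] using h
  · rintro _ ⟨a, ha, rfl⟩ _ ⟨b, hb, rfl⟩
    exact hC a ha b hb

/-- Layer cake formula for functions with values in `[0, 1]`. -/
lemma lintegral_eq_lintegral_Ioo_meas_lt {f : ℝ → ENNReal} (hf : Measurable f)
    (hf1 : ∀ x, f x ≤ 1) :
    ∫⁻ x, f x = ∫⁻ r in Set.Ioo (0 : ℝ) 1, volume {x | ENNReal.ofReal r < f x} := by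
  have hne : ∀ x, f x ≠ ⊤ := fun x => ((hf1 x).trans_lt ENNReal.one_lt_top).ne
  have h := lintegral_eq_lintegral_meas_lt volume (f := fun x => (f x).toReal)
    (Eventually.of_forall fun _ => ENNReal.toReal_nonneg) hf.ennreal_toReal.aemeasurable
  simp only [ENNReal.ofReal_toReal (hne _)] at h
  rw [h, ← Set.Ioo_union_Ici_eq_Ioi zero_lt_one, lintegral_union measurableSet_Ici]
  · have : ∫⁻ r in Set.Ici (1 : ℝ), volume {x | r < (f x).toReal} = 0 := by
      rw [setLIntegral_congr_fun (g := fun _ => 0) measurableSet_Ici, lintegral_zero]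
      intro r hr
      have : {x | r < (f x).toReal} = ∅ := by
        ext x
        simp only [Set.mem_ofPred_eq, Set.mem_empty_iff_false, iff_false, not_lt]
        exact (ENNReal.toReal_mono ENNReal.one_ne_top (hf1 x)).trans (by simpa using hr)
      simp only [this, measure_empty]
    rw [this, add_zero]
    refine setLIntegral_congr_fun measurableSet_Ioo fun r hr => ?_
    simp only [ENNReal.ofReal_lt_iff_lt_toReal hr.1.le (hne _)]
  · rw [Set.disjoint_left]
    rintro x hx hx'
    exact absurd hx.2 (not_lt.2 hx')

/-- The Prékopa–Leindler inequality on the line for functions with supremum one. -/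
lemma prekopaLeindler_of_iSup_eq_one {f g h : ℝ → ENNReal} (hf : Measurable f) (hg : Measurable g)
    (hh : Measurable h) (hf1 : ⨆ x, f x = 1) (hg1 : ⨆ x, g x = 1) {s t : ℝ} (hs : 0 < s)
    (ht : 0 < t) (hst : s + t = 1)
    (hfg : ∀ x y, f x ^ s * g y ^ t ≤ h (s * x + t * y)) :
    (∫⁻ x, f x) ^ s * (∫⁻ x, g x) ^ t ≤ ∫⁻ x, h x := by
  have hfle : ∀ x, f x ≤ 1 := fun x => hf1 ▸ le_iSup f x
  have hgle : ∀ x, g x ≤ 1 := fun x => hg1 ▸ le_iSup g x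
  set h' : ℝ → ENNReal := fun x => min (h x) 1 with hh'
  have hfg' : ∀ x y, f x ^ s * g y ^ t ≤ h' (s * x + t * y) := fun x y =>
    le_min (hfg x y) (mul_le_one' (ENNReal.rpow_le_one (hfle x) hs.le)
      (ENNReal.rpow_le_one (hgle y) ht.le))
  have hlev : ∀ r ∈ Set.Ioo (0 : ℝ) 1,
      ENNReal.ofReal s * volume {x | ENNReal.ofReal r < f x}
        + ENNReal.ofReal t * volume {x | ENNReal.ofReal r < g x}
        ≤ volume {x | ENNReal.ofReal r < h' x} := by
    intro r hr
    have hr1 : ENNReal.ofReal r < 1 := by simpa using hr.2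
    have hr0 : 0 < ENNReal.ofReal r := by simpa using hr.1
    refine volume_convexComb_le (measurableSet_lt measurable_const hf)
      (measurableSet_lt measurable_const hg) ?_ ?_ hs ht ?_
    · exact lt_iSup_iff.1 (hf1 ▸ hr1)
    · exact lt_iSup_iff.1 (hg1 ▸ hr1)
    · intro a ha b hb
      refine lt_of_lt_of_le ?_ (hfg' a b)
      calc ENNReal.ofReal r = ENNReal.ofReal r ^ s * ENNReal.ofReal r ^ t := by
            rw [← ENNReal.rpow_add _ _ hr0.ne' ENNReal.ofReal_ne_top, hst, ENNReal.rpow_one]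
        _ < f a ^ s * g b ^ t := ENNReal.mul_lt_mul (ENNReal.rpow_lt_rpow ha hs)
            (ENNReal.rpow_lt_rpow hb ht)
  have harith : ∀ a b : ENNReal, a ^ s * b ^ t ≤ ENNReal.ofReal s * a + ENNReal.ofReal t * b := by
    intro a b
    have hpq : (s⁻¹).HolderConjugate t⁻¹ :=
      Real.holderConjugate_iff.2 ⟨(one_lt_inv₀ hs).2 (by linarith), by simpa using hst⟩
    have := ENNReal.young_inequality (a ^ s) (b ^ t) hpq
    rw [← ENNReal.rpow_mul, ← ENNReal.rpow_mul, mul_inv_cancel₀ hs.ne', mul_inv_cancel₀ ht.ne',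
      ENNReal.rpow_one, ENNReal.rpow_one, ENNReal.ofReal_inv_of_pos hs,
      ENNReal.ofReal_inv_of_pos ht, div_eq_mul_inv, div_eq_mul_inv, inv_inv, inv_inv,
      mul_comm a, mul_comm b] at this
    exact this
  calc (∫⁻ x, f x) ^ s * (∫⁻ x, g x) ^ t
      ≤ ENNReal.ofReal s * (∫⁻ x, f x) + ENNReal.ofReal t * ∫⁻ x, g x := harith _ _
    _ ≤ ∫⁻ x, h' x := by
      rw [lintegral_eq_lintegral_Ioo_meas_lt hf hfle, lintegral_eq_lintegral_Ioo_meas_lt hg hgle,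
        lintegral_eq_lintegral_Ioo_meas_lt (hh.min measurable_const) fun x => min_le_right _ _,
        ← lintegral_const_mul' _ _ ENNReal.ofReal_ne_top,
        ← lintegral_const_mul' _ _ ENNReal.ofReal_ne_top]
      refine (le_lintegral_add _ _).trans (setLIntegral_mono' measurableSet_Ioo hlev)
    _ ≤ ∫⁻ x, h x := lintegral_mono fun x => min_le_left _ _

lemma prekopaLeindler_of_iSup_ne_top {f g h : ℝ → ENNReal} (hf : Measurable f) (hg : Measurable g)
    (hh : Measurable h) (hf1 : ⨆ x, f x ≠ ⊤) (hg1 : ⨆ x, g x ≠ ⊤) {s t : ℝ} (hs : 0 < s)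
    (ht : 0 < t) (hst : s + t = 1)
    (hfg : ∀ x y, f x ^ s * g y ^ t ≤ h (s * x + t * y)) :
    (∫⁻ x, f x) ^ s * (∫⁻ x, g x) ^ t ≤ ∫⁻ x, h x := by
  set F := ⨆ x, f x with hF
  set G := ⨆ x, g x with hG
  rcases eq_or_ne F 0 with h0 | hF0
  · have : ∀ x, f x = 0 := by simpa [hF, ENNReal.iSup_eq_zero] using h0
    simp [this, ENNReal.zero_rpow_of_pos hs]
  rcases eq_or_ne G 0 with h0 | hG0
  · have : ∀ x, g x = 0 := by simpa [hG, ENNReal.iSup_eq_zero] using h0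
    simp [this, ENNReal.zero_rpow_of_pos ht]
  have hFi : F⁻¹ ≠ ⊤ := ENNReal.inv_ne_top.2 hF0
  have hGi : G⁻¹ ≠ ⊤ := ENNReal.inv_ne_top.2 hG0
  have key := prekopaLeindler_of_iSup_eq_one (f := fun x => F⁻¹ * f x) (g := fun x => G⁻¹ * g x)
    (h := fun x => (F⁻¹ ^ s * G⁻¹ ^ t) * h x) (hf.const_mul _) (hg.const_mul _) (hh.const_mul _)
    (by rw [← ENNReal.mul_iSup, ← hF, ENNReal.inv_mul_cancel hF0 hf1])
    (by rw [← ENNReal.mul_iSup, ← hG, ENNReal.inv_mul_cancel hG0 hg1]) hs ht hst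
    (fun x y => by
      rw [ENNReal.mul_rpow_of_nonneg _ _ hs.le, ENNReal.mul_rpow_of_nonneg _ _ ht.le,
        mul_mul_mul_comm]
      exact mul_le_mul_right (hfg x y) _)
  have hc : F⁻¹ ^ s * G⁻¹ ^ t ≠ ⊤ := ENNReal.mul_ne_top
    (ENNReal.rpow_ne_top_of_nonneg hs.le hFi) (ENNReal.rpow_ne_top_of_nonneg ht.le hGi)
  have hc0 : F⁻¹ ^ s * G⁻¹ ^ t ≠ 0 := mul_ne_zero
    (ENNReal.rpow_pos (ENNReal.inv_pos.2 hf1) hFi).ne'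
    (ENNReal.rpow_pos (ENNReal.inv_pos.2 hg1) hGi).ne'
  rw [lintegral_const_mul' _ _ hFi, lintegral_const_mul' _ _ hGi, lintegral_const_mul' _ _ hc,
    ENNReal.mul_rpow_of_nonneg _ _ hs.le, ENNReal.mul_rpow_of_nonneg _ _ ht.le,
    mul_mul_mul_comm] at key
  exact (ENNReal.mul_le_mul_iff_right hc0 hc).1 key

/-- The Prékopa–Leindler inequality on the line. -/
lemma prekopaLeindler_real {f g h : ℝ → ENNReal} (hf : Measurable f) (hg : Measurable g)
    (hh : Measurable h) {s t : ℝ} (hs : 0 < s) (ht : 0 < t) (hst : s + t = 1)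
    (hfg : ∀ x y, f x ^ s * g y ^ t ≤ h (s * x + t * y)) :
    (∫⁻ x, f x) ^ s * (∫⁻ x, g x) ^ t ≤ ∫⁻ x, h x := by
  rcases eq_or_ne (∫⁻ x, f x) 0 with h0 | hf0
  · simp [h0, ENNReal.zero_rpow_of_pos hs]
  rcases eq_or_ne (∫⁻ x, g x) 0 with h0 | hg0
  · simp [h0, ENNReal.zero_rpow_of_pos ht]
  have hlim : ∀ {f : ℝ → ENNReal}, Measurable f →
      Tendsto (fun k : ℕ => ∫⁻ x, min (f x) k) atTop (nhds (∫⁻ x, f x)) := by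
    intro f hf
    refine lintegral_tendsto_of_tendsto_of_monotone
      (fun k => (hf.min measurable_const).aemeasurable) ?_ ?_
    · refine Eventually.of_forall fun x i j hij => ?_
      exact min_le_min_left _ (by exact_mod_cast hij)
    · refine Eventually.of_forall fun x => ?_
      have := (tendsto_const_nhds (x := f x)).min ENNReal.tendsto_nat_nhds_top
      simpa using this
  have hL := ENNReal.Tendsto.mul
    ((ENNReal.continuous_rpow_const (y := s)).continuousAt.tendsto.comp (hlim hf))
    (Or.inl (by simp [hf0, hs.le, hs]))
    ((ENNReal.continuous_rpow_const (y := t)).continuousAt.tendsto.comp (hlim hg))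
    (Or.inl (by simp [hg0, ht.le, ht]))
  refine le_of_tendsto' hL fun k => ?_
  have hb : ∀ f : ℝ → ENNReal, ⨆ x, min (f x) k ≠ ⊤ := fun f =>
    ((iSup_le fun x => min_le_right _ _).trans_lt (ENNReal.natCast_lt_top k)).ne
  refine prekopaLeindler_of_iSup_ne_top (hf.min measurable_const) (hg.min measurable_const) hh
    (hb f) (hb g) hs ht hst fun x y => le_trans ?_ (hfg x y)
  exact mul_le_mul' (ENNReal.rpow_le_rpow (min_le_left _ _) hs.le)
    (ENNReal.rpow_le_rpow (min_le_left _ _) ht.le)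

lemma lintegral_fin_succ {m : ℕ} {f : (Fin (m + 1) → ℝ) → ENNReal} (hf : Measurable f) :
    ∫⁻ x, f x = ∫⁻ a : ℝ, ∫⁻ y : Fin m → ℝ, f (Fin.cons a y) := by
  have h := (volume_preserving_piFinSuccAbove (fun _ : Fin (m + 1) => ℝ) 0).symm
  rw [← h.lintegral_comp hf, Measure.volume_eq_prod, lintegral_prod]
  · simp [MeasurableEquiv.piFinSuccAbove, Fin.consEquiv]
  · exact (hf.comp h.measurable).aemeasurable

/-- The Prékopa–Leindler inequality. -/
lemma prekopaLeindler {m : ℕ} {f g h : (Fin m → ℝ) → ENNReal} (hf : Measurable f)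
    (hg : Measurable g) (hh : Measurable h) {s t : ℝ} (hs : 0 < s) (ht : 0 < t) (hst : s + t = 1)
    (hfg : ∀ x y, f x ^ s * g y ^ t ≤ h (s • x + t • y)) :
    (∫⁻ x, f x) ^ s * (∫⁻ x, g x) ^ t ≤ ∫⁻ x, h x := by
  induction m with
  | zero =>
    have e : ∀ f : (Fin 0 → ℝ) → ENNReal, ∫⁻ x, f x = f 0 := by
      intro f
      rw [lintegral_unique, volume_pi, Measure.pi_of_empty]
      simp only [measure_univ, mul_one]
      exact congrArg f (Subsingleton.elim _ _)
    rw [e, e, e]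
    simpa using hfg 0 0
  | succ m ih =>
    have hm : Measurable fun z : ℝ × (Fin m → ℝ) => (Fin.cons z.1 z.2 : Fin (m + 1) → ℝ) := by
      refine measurable_pi_lambda _ fun i => ?_
      refine Fin.cases ?_ (fun j => ?_) i
      · simpa using measurable_fst
      · simpa [Function.comp_def] using (measurable_pi_apply j).comp measurable_snd
    have hm1 : ∀ {f : (Fin (m + 1) → ℝ) → ENNReal}, Measurable f →
        Measurable fun a : ℝ => ∫⁻ y : Fin m → ℝ, f (Fin.cons a y) := fun hf =>
      (hf.comp hm).lintegral_prod_right'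
    have hm2 : ∀ {f : (Fin (m + 1) → ℝ) → ENNReal} (a : ℝ), Measurable f →
        Measurable fun y : Fin m → ℝ => f (Fin.cons a y) := fun a hf =>
      hf.comp (hm.comp measurable_prodMk_left)
    rw [lintegral_fin_succ hf, lintegral_fin_succ hg, lintegral_fin_succ hh]
    refine prekopaLeindler_real (hm1 hf) (hm1 hg) (hm1 hh) hs ht hst fun a b => ?_
    refine ih (hm2 a hf) (hm2 b hg) (hm2 _ hh) fun x y => (hfg _ _).trans_eq ?_
    congr 1
    ext i
    refine Fin.cases ?_ (fun j => ?_) i <;> simp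

/-- The sharp Poincaré inequality on the line for a log-concave density whose support has length
at most `d`, up to an arbitrarily small error. -/
lemma poincare_withDensity {p : ℝ} (hp : 2 ≤ p) {d L : ℝ} (hL : 0 < L) (hlen : d * L < piP p)
    {ρ : ℝ → ENNReal} (hρ : Measurable ρ) (hfin : ∀ t, ρ t ≠ ⊤)
    (hlc : ∀ a b s t : ℝ, 0 < s → 0 < t → s + t = 1 →
      ρ a ^ s * ρ b ^ t ≤ ρ (s * a + t * b))
    (hd : ∀ a b, ρ a ≠ 0 → ρ b ≠ 0 → a - b ≤ d)
    [IsFiniteMeasure (volume.withDensity ρ)]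
    {G G' : ℝ → ℝ} (hG : ∀ t, HasDerivAt G (G' t) t) (hG' : Continuous G') {M M' : ℝ}
    (hM : 0 ≤ M) (hGM : ∀ t, |G t| ≤ M) (hGM' : ∀ t, |G' t| ≤ M') {η : ℝ} (hη : 0 < η) :
    ∃ c ∈ Set.Icc (-M) M, ∫ t, |G t - c| ^ p ∂volume.withDensity ρ ≤
      (L ^ p)⁻¹ * (∫ t, |G' t| ^ p ∂volume.withDensity ρ) + η := by
  have hp0 : 0 ≤ p := by linarith
  have hGc : Continuous G := continuous_iff_continuousAt.2 fun t => (hG t).continuousAt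
  set ν := volume.withDensity ρ with hν
  set I : Set ℝ := {t | ρ t ≠ 0} with hI
  have hIm : MeasurableSet I := (hρ (measurableSet_singleton 0)).compl
  have hIc : Convex ℝ I := by
    refine convex_iff_forall_pos.2 fun a ha b hb s t hs ht hst => ?_
    have h := hlc a b s t hs ht hst
    intro h0
    simp only [smul_eq_mul] at h0
    rw [h0, nonpos_iff_eq_zero, mul_eq_zero] at h
    rcases h with h | h
    · exact ha ((ENNReal.rpow_eq_zero_iff_of_pos hs).1 h)
    · exact hb ((ENNReal.rpow_eq_zero_iff_of_pos ht).1 h)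
  set U := interior I with hU
  have hUc : Convex ℝ U := hIc.interior
  have hUo : IsOpen U := isOpen_interior
  have hνU : ν Uᶜ = 0 := by
    have h1 : Uᶜ ⊆ Iᶜ ∪ frontier I := by
      intro x hx
      by_cases hxI : x ∈ I
      · exact Or.inr ⟨subset_closure hxI, hx⟩
      · exact Or.inl hxI
    refine measure_mono_null h1 (measure_union_null ?_ ?_)
    · rw [hν, withDensity_apply _ hIm.compl]
      refine setLIntegral_eq_zero hIm.compl ?_
      intro x hx
      simpa [hI] using hx
    · exact withDensity_absolutelyContinuous _ _ (hIc.addHaar_frontier volume)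
  set B : ℝ := (2 * M) ^ p with hB
  have hB0 : 0 ≤ B := by positivity
  obtain ⟨K, hKU, hKc, hKν⟩ := hUo.measurableSet.exists_isCompact_sdiff_lt (μ := ν)
    (measure_ne_top _ _) (ε := ENNReal.ofReal (η / (B + 1)))
    (by simpa using (by positivity : 0 < η / (B + 1)))
  have hG1 : ∀ c ∈ Set.Icc (-M) M, ∀ t, |G t - c| ^ p ≤ B := fun c hc t => by
    refine Real.rpow_le_rpow (abs_nonneg _) ?_ hp0
    have := abs_le.1 (hGM t)
    rw [abs_le]; constructor <;> linarith [hc.1, hc.2, this.1, this.2]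
  have hcont : ∀ c, Continuous fun t => |G t - c| ^ p := fun c =>
    (hGc.sub continuous_const).abs.rpow_const fun _ => Or.inr hp0
  have hcont' : Continuous fun t => |G' t| ^ p := hG'.abs.rpow_const fun _ => Or.inr hp0
  have hInt : ∀ c ∈ Set.Icc (-M) M, Integrable (fun t => |G t - c| ^ p) ν := fun c hc =>
    Integrable.of_bound (hcont c).aestronglyMeasurable B <| ae_of_all _ fun t => by
      rw [Real.norm_of_nonneg (by positivity)]; exact hG1 c hc t
  have hInt' : Integrable (fun t => |G' t| ^ p) ν :=
    Integrable.of_bound hcont'.aestronglyMeasurable (M' ^ p) <| ae_of_all _ fun t => by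
      rw [Real.norm_of_nonneg (by positivity)]
      exact Real.rpow_le_rpow (abs_nonneg _) (hGM' t) hp0
  suffices h : ∃ c ∈ Set.Icc (-M) M, ∃ S, MeasurableSet S ∧ ν Sᶜ ≤ ENNReal.ofReal (η / (B + 1)) ∧
      ∫ t in S, |G t - c| ^ p ∂ν ≤ (L ^ p)⁻¹ * ∫ t in S, |G' t| ^ p ∂ν by
    obtain ⟨c, hc, S, hS, hνS, hle⟩ := h
    refine ⟨c, hc, ?_⟩
    rw [← integral_add_compl hS (hInt c hc)]
    refine add_le_add (hle.trans ?_) ?_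
    · refine mul_le_mul_of_nonneg_left ?_ (by positivity)
      exact setIntegral_le_integral hInt' (ae_of_all _ fun t => by positivity)
    · have h1 : ∫ t in Sᶜ, |G t - c| ^ p ∂ν ≤ ∫ t in Sᶜ, B ∂ν :=
        setIntegral_mono (hInt c hc).integrableOn (integrable_const _) fun t => hG1 c hc t
      refine h1.trans ?_
      rw [setIntegral_const, smul_eq_mul]
      have h2 : ν.real Sᶜ ≤ η / (B + 1) :=
        ENNReal.toReal_le_of_le_ofReal (by positivity) hνS
      calc ν.real Sᶜ * B ≤ η / (B + 1) * B := by gcongr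
        _ ≤ η := by
          rw [div_mul_eq_mul_div, div_le_iff₀ (by positivity)]; nlinarith
  have hsmall : ∀ S : Set ℝ, K ⊆ S → ν Sᶜ ≤ ENNReal.ofReal (η / (B + 1)) := fun S hS => by
    have h1 : Sᶜ ⊆ (U \ K) ∪ Uᶜ := by
      intro x hx
      by_cases hxU : x ∈ U
      · exact Or.inl ⟨hxU, fun h => hx (hS h)⟩
      · exact Or.inr hxU
    calc ν Sᶜ ≤ ν (U \ K) + ν Uᶜ := (measure_mono h1).trans (measure_union_le _ _)
      _ ≤ _ := by rw [hνU, add_zero]; exact hKν.le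
  rcases K.eq_empty_or_nonempty with hKe | hKn
  · exact ⟨0, ⟨by linarith, hM⟩, ∅, MeasurableSet.empty, hsmall ∅ (by rw [hKe]), by simp⟩
  set α := sInf K
  set β := sSup K
  have hα : α ∈ K := hKc.sInf_mem hKn
  have hβ : β ∈ K := hKc.sSup_mem hKn
  have hαβ : α ≤ β := csInf_le hKc.bddBelow hβ
  have hsub : Set.Icc α β ⊆ U := hUc.ordConnected.out (hKU hα) (hKU hβ)
  have hUI : U ⊆ I := interior_subset
  have hpos : ∀ t ∈ U, 0 < (ρ t).toReal := fun t ht => ENNReal.toReal_pos (hUI ht) (hfin t)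
  have hcc : ConcaveOn ℝ U fun t => Real.log (ρ t).toReal := by
    refine concaveOn_iff_forall_pos.2 ⟨hUc, fun a ha b hb s t hs ht hst => ?_⟩
    have h := ENNReal.toReal_mono (hfin _) (hlc a b s t hs ht hst)
    rw [ENNReal.toReal_mul, ← ENNReal.toReal_rpow, ← ENNReal.toReal_rpow] at h
    have hpa := hpos a ha
    have hpb := hpos b hb
    have h' := Real.log_le_log (by positivity) h
    rwa [Real.log_mul (by positivity) (by positivity), Real.log_rpow hpa,
      Real.log_rpow hpb] at h'
  set φ := fun t : ℝ => Real.log (ρ t).toReal with hφ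
  have hφc : ContinuousOn φ U := hcc.continuousOn hUo
  have hψc : Continuous (Set.IccExtend hαβ ((Set.Icc α β).domRestrict φ)) :=
    ((hφc.mono hsub).domRestrict).Icc_extend'
  have hψ : ∀ t ∈ Set.Icc α β, Set.IccExtend hαβ ((Set.Icc α β).domRestrict φ) t = φ t :=
    fun t ht => by rw [Set.IccExtend_of_mem _ _ ht]; rfl
  obtain ⟨c, hc, hle⟩ := poincare_logConcave hp hαβ hL (lt_of_le_of_lt
      (mul_le_mul_of_nonneg_right (hd β α (hUI (hKU hβ)) (hUI (hKU hα))) hL.le) hlen)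
    (ρ := fun t => Real.exp (Set.IccExtend hαβ ((Set.Icc α β).domRestrict φ) t))
    (Real.continuous_exp.comp hψc) (fun t => Real.exp_pos _)
    (by
      refine (hcc.subset hsub (convex_Icc α β)).congr fun t ht => ?_
      simp only [Real.log_exp]
      exact (hψ t ht).symm) hG hG' hM hGM
  refine ⟨c, hc, Set.Icc α β, measurableSet_Icc,
    hsmall _ fun x hx => ⟨csInf_le hKc.bddBelow hx, le_csSup hKc.bddAbove hx⟩, ?_⟩
  have key : ∀ g : ℝ → ℝ, ∫ t in Set.Icc α β, g t ∂ν = ∫ t in α..β,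
      g t * Real.exp (Set.IccExtend hαβ ((Set.Icc α β).domRestrict φ) t) := fun g => by
    rw [intervalIntegral.integral_of_le hαβ, ← integral_Icc_eq_integral_Ioc, hν,
      setIntegral_withDensity_eq_setIntegral_toReal_smul hρ
        (ae_of_all _ fun t => (hfin t).lt_top) _ measurableSet_Icc]
    refine setIntegral_congr_fun measurableSet_Icc fun t ht => ?_
    simp only [smul_eq_mul]
    rw [hψ t ht, hφ, Real.exp_log (hpos t (hsub ht)), mul_comm]
  rw [key, key]
  exact hle

/-- The marginal of a bounded, compactly supported log-concave density along a direction is a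
log-concave density on the line. -/
lemma exists_logConcave_marginal {m : ℕ} {e : EuclideanSpace ℝ (Fin (m + 1))} (he : ‖e‖ = 1)
    {F : EuclideanSpace ℝ (Fin (m + 1)) → ENNReal} (hF : Measurable F) {B : ENNReal} (hB : B ≠ ⊤)
    (hFB : ∀ x, F x ≤ B) {R : ℝ} (hFR : ∀ x, F x ≠ 0 → ‖x‖ ≤ R)
    (hlc : ∀ x y, ∀ s t : ℝ, 0 < s → 0 < t → s + t = 1 → F x ^ s * F y ^ t ≤ F (s • x + t • y)) :
    ∃ ρ : ℝ → ENNReal, Measurable ρ ∧ (∀ t, ρ t ≠ ⊤) ∧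
      (∀ a b s t : ℝ, 0 < s → 0 < t → s + t = 1 → ρ a ^ s * ρ b ^ t ≤ ρ (s * a + t * b)) ∧
      (∀ t, ρ t ≠ 0 → ∃ x, F x ≠ 0 ∧ ⟪x, e⟫ = t) ∧
      ∀ g : ℝ → ENNReal, Measurable g → ∫⁻ x, F x * g ⟪x, e⟫ = ∫⁻ t, ρ t * g t := by
  obtain ⟨b, hb⟩ := Orthonormal.exists_orthonormalBasis_extension_of_card_eq (𝕜 := ℝ)
    (ι := Fin (m + 1)) (E := EuclideanSpace ℝ (Fin (m + 1))) (by simp) (v := fun _ => e) (s := {0})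
    (by
      refine ⟨fun _ => he, fun i j hij => (hij ?_).elim⟩
      exact Subsingleton.elim i j)
  have hb0 : b 0 = e := hb 0 rfl
  set Φ : (Fin (m + 1) → ℝ) ≃L[ℝ] EuclideanSpace ℝ (Fin (m + 1)) :=
    (EuclideanSpace.equiv (Fin (m + 1)) ℝ).symm.trans b.repr.symm.toContinuousLinearEquiv with hΦ
  have hΦv : MeasurePreserving Φ volume volume :=
    b.repr.symm.measurePreserving.comp (EuclideanSpace.volume_preserving_symm_measurableEquiv_toLp _).symm
  have hΦ0 : ∀ z, ⟪Φ z, e⟫ = z 0 := fun z => by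
    rw [← hb0, real_inner_comm, ← b.repr_apply_apply]
    simp [hΦ]
  have hΦn : ∀ z i, |z i| ≤ ‖Φ z‖ := fun z i => by
    have : ‖Φ z‖ = ‖(WithLp.toLp 2 z : EuclideanSpace ℝ (Fin (m + 1)))‖ := by
      simp [hΦ]
    rw [this]
    exact PiLp.norm_apply_le (WithLp.toLp 2 z : EuclideanSpace ℝ (Fin (m + 1))) i
  have hcons : Measurable fun z : ℝ × (Fin m → ℝ) => (Fin.cons z.1 z.2 : Fin (m + 1) → ℝ) := by
    refine measurable_pi_lambda _ fun i => ?_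
    refine Fin.cases ?_ (fun j => ?_) i
    · simpa using measurable_fst
    · simpa [Function.comp_def] using (measurable_pi_apply j).comp measurable_snd
  have hFΦ : Measurable fun z => F (Φ z) := hF.comp Φ.continuous.measurable
  have hslice : ∀ t : ℝ, Measurable fun y : Fin m → ℝ => F (Φ (Fin.cons t y)) := fun t =>
    hFΦ.comp (hcons.comp measurable_prodMk_left)
  refine ⟨fun t => ∫⁻ y : Fin m → ℝ, F (Φ (Fin.cons t y)), (hFΦ.comp hcons).lintegral_prod_right',
    fun t => ?_, fun a c s t hs ht hst => ?_, fun t ht => ?_, fun g hg => ?_⟩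
  · refine ne_top_of_le_ne_top (b := ∫⁻ y, (Metric.closedBall (0 : Fin m → ℝ) R).indicator
      (fun _ => B) y) ?_ (lintegral_mono fun y => ?_)
    · rw [lintegral_indicator Metric.isClosed_closedBall.measurableSet, setLIntegral_const]
      exact ENNReal.mul_ne_top hB (isCompact_closedBall _ _).measure_lt_top.ne
    · by_cases h : F (Φ (Fin.cons t y)) = 0
      · simp only [h]; exact bot_le
      · have hR := hFR _ h
        rw [Set.indicator_of_mem]
        · exact hFB _
        · rw [mem_closedBall_zero_iff, pi_norm_le_iff_of_nonneg ((norm_nonneg _).trans hR)]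
          intro i
          have := hΦn (Fin.cons t y) i.succ
          simp only [Fin.cons_succ] at this
          exact this.trans hR
  · refine prekopaLeindler (hslice a) (hslice c) (hslice _) hs ht hst fun x y => ?_
    refine (hlc _ _ s t hs ht hst).trans_eq ?_
    rw [← map_smul, ← map_smul, ← map_add]
    congr 2
    ext i
    refine Fin.cases ?_ (fun j => ?_) i <;> simp
  · by_contra! h
    refine ht ?_
    simp only
    rw [lintegral_eq_zero_iff (hslice t)]
    refine ae_of_all _ fun y => ?_
    by_contra h0
    exact h _ h0 (by rw [hΦ0]; simp)
  · have hT : Measurable fun x : EuclideanSpace ℝ (Fin (m + 1)) => ⟪x, e⟫ := by fun_prop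
    have hFg : Measurable fun x => F x * g ⟪x, e⟫ := hF.mul (hg.comp hT)
    have hFg' : Measurable fun z => F (Φ z) * g ⟪Φ z, e⟫ := hFg.comp Φ.continuous.measurable
    rw [← hΦv.lintegral_comp hFg, lintegral_fin_succ hFg']
    refine lintegral_congr fun t => ?_
    simp only [hΦ0, Fin.cons_zero]
    rw [lintegral_mul_const _ (hslice t)]

lemma indicator_ofReal_logConcave {E : Type*} [AddCommGroup E] [Module ℝ E] {K : Set E}
    (hK : Convex ℝ K) {w : E → ℝ} (hw : ∀ x ∈ K, 0 < w x)
    (hlc : ∀ x ∈ K, ∀ y ∈ K, ∀ s t : ℝ, 0 < s → 0 < t → s + t = 1 →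
      w x ^ s * w y ^ t ≤ w (s • x + t • y)) (x y : E) {s t : ℝ} (hs : 0 < s) (ht : 0 < t)
    (hst : s + t = 1) :
    K.indicator (fun x => ENNReal.ofReal (w x)) x ^ s *
      K.indicator (fun x => ENNReal.ofReal (w x)) y ^ t ≤
        K.indicator (fun x => ENNReal.ofReal (w x)) (s • x + t • y) := by
  by_cases hx : x ∈ K
  swap
  · simp [hx, ENNReal.zero_rpow_of_pos hs]
  by_cases hy : y ∈ K
  swap
  · simp [hy, ENNReal.zero_rpow_of_pos ht]
  rw [Set.indicator_of_mem hx, Set.indicator_of_mem hy,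
    Set.indicator_of_mem (hK hx hy hs.le ht.le hst), ENNReal.ofReal_rpow_of_pos (hw x hx),
    ENNReal.ofReal_rpow_of_pos (hw y hy),
    ← ENNReal.ofReal_mul (Real.rpow_nonneg (hw x hx).le _)]
  exact ENNReal.ofReal_le_ofReal (hlc x hx y hy s t hs ht hst)

/-- The weighted Poincaré inequality on a convex set contained in a thin neighbourhood of a
line. -/
lemma poincare_of_near_line {m : ℕ} {p : ℝ} (hp : 2 ≤ p) {d L : ℝ} (hL : 0 < L)
    (hlen : d * L < piP p) {K : Set (EuclideanSpace ℝ (Fin (m + 1)))} (hKm : MeasurableSet K)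
    (hKc : Convex ℝ K) {R : ℝ} (hKR : ∀ x ∈ K, ‖x‖ ≤ R) (hKd : ∀ x ∈ K, ∀ y ∈ K, dist x y ≤ d)
    {w : EuclideanSpace ℝ (Fin (m + 1)) → ℝ} (hw : ContinuousOn w K) (hwpos : ∀ x ∈ K, 0 < w x)
    {B : ℝ} (hwB : ∀ x ∈ K, w x ≤ B)
    (hwlc : ∀ x ∈ K, ∀ y ∈ K, ∀ s t : ℝ, 0 < s → 0 < t → s + t = 1 →
      w x ^ s * w y ^ t ≤ w (s • x + t • y))
    {a e : EuclideanSpace ℝ (Fin (m + 1))} (he : ‖e‖ = 1) {δ : ℝ}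
    (hδ : ∀ x ∈ K, dist (a + ⟪x - a, e⟫ • e) x ≤ δ)
    {g : EuclideanSpace ℝ (Fin (m + 1)) → ℝ} (hg : ContDiff ℝ 1 g) {M M' : ℝ}
    (hgM : ∀ x, |g x| ≤ M) (hgM' : ∀ x, ‖gradient g x‖ ≤ M') {ε : ℝ}
    (hε1 : ∀ c ∈ Set.Icc (-M) M, ∀ x y, dist x y ≤ δ → |g y - c| ^ p ≤ |g x - c| ^ p + ε)
    (hε2 : ∀ x y, dist x y ≤ δ → ‖gradient g x‖ ^ p ≤ ‖gradient g y‖ ^ p + ε)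
    (hzero : ∫ x in K, signedPow p (g x) * w x = 0) :
    ∫ x in K, |g x| ^ p * w x ≤ (L ^ p)⁻¹ * (∫ x in K, ‖gradient g x‖ ^ p * w x) +
      ((L ^ p)⁻¹ + 1) * ε * ∫ x in K, w x := by
  have hp0 : 0 ≤ p := by linarith
  have hM : 0 ≤ M := (abs_nonneg _).trans (hgM 0)
  have hM' : 0 ≤ M' := (norm_nonneg _).trans (hgM' 0)
  set a' := a - ⟪a, e⟫ • e with ha'
  have hπ : ∀ x, a' + ⟪x, e⟫ • e = a + ⟪x - a, e⟫ • e := fun x => by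
    rw [ha', inner_sub_left, sub_smul]; abel
  have hKfin : volume K < ⊤ :=
    (measure_mono fun x hx => mem_closedBall_zero_iff.2 (hKR x hx)).trans_lt
      (isCompact_closedBall (0 : EuclideanSpace ℝ (Fin (m + 1))) R).measure_lt_top
  have hwi : IntegrableOn w K :=
    IntegrableOn.of_bound hKfin (hw.aestronglyMeasurable hKm) B <|
      (ae_restrict_iff' hKm).2 <| ae_of_all _ fun x hx => by
        rw [Real.norm_of_nonneg (hwpos x hx).le]; exact hwB x hx
  have hInt : ∀ q : EuclideanSpace ℝ (Fin (m + 1)) → ℝ, Continuous q → ∀ D, (∀ x, |q x| ≤ D) →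
      IntegrableOn (fun x => q x * w x) K := fun q hq D hD =>
    Integrable.bdd_mul (c := D) hwi hq.aestronglyMeasurable (ae_of_all _ hD)
  set F := K.indicator fun x => ENNReal.ofReal (w x) with hF
  have hFm : Measurable F := by
    classical
    rw [hF, ← Set.piecewise_eq_indicator]
    exact (ENNReal.continuous_ofReal.comp_continuousOn hw).measurable_piecewise
      continuousOn_const hKm
  have hF0 : ∀ x, F x ≠ 0 → x ∈ K := fun x hx => by
    by_contra h
    exact hx (Set.indicator_of_notMem h _)
  obtain ⟨ρ, hρm, hρt, hρlc, hρ0, hρint⟩ := exists_logConcave_marginal he hFm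
    (B := ENNReal.ofReal B) ENNReal.ofReal_ne_top (fun x => by
      by_cases h : x ∈ K
      · rw [hF, Set.indicator_of_mem h]; exact ENNReal.ofReal_le_ofReal (hwB x h)
      · rw [hF, Set.indicator_of_notMem h]; exact bot_le)
    (fun x hx => hKR x (hF0 x hx))
    (fun x y s t hs ht hst => indicator_ofReal_logConcave hKc hwpos hwlc x y hs ht hst)
  have hlint : ∀ q : ℝ → ENNReal, Measurable q →
      ∫⁻ x in K, ENNReal.ofReal (w x) * q ⟪x, e⟫ = ∫⁻ t, q t ∂volume.withDensity ρ := by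
    intro q hq
    rw [lintegral_withDensity_eq_lintegral_mul _ hρm hq]
    simp only [Pi.mul_apply]
    rw [← hρint q hq, ← lintegral_indicator hKm]
    refine lintegral_congr fun x => ?_
    by_cases h : x ∈ K <;> simp [hF, h]
  have hfin : IsFiniteMeasure (volume.withDensity ρ) := by
    refine ⟨?_⟩
    rw [← lintegral_one, ← hlint _ measurable_const]
    simp only [mul_one]
    refine lt_of_le_of_lt (lintegral_mono fun x => ?_) hwi.2
    exact Real.ofReal_le_enorm _
  have htrans : ∀ q : ℝ → ℝ, Continuous q → (∀ t, 0 ≤ q t) →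
      ∫ x in K, q ⟪x, e⟫ * w x = ∫ t, q t ∂volume.withDensity ρ := by
    intro q hq hq0
    have hT : Continuous fun x : EuclideanSpace ℝ (Fin (m + 1)) => q ⟪x, e⟫ := by fun_prop
    rw [integral_eq_lintegral_of_nonneg_ae, integral_eq_lintegral_of_nonneg_ae,
      ← hlint _ hq.measurable.ennreal_ofReal]
    · congr 1
      refine lintegral_congr fun x => ?_
      rw [mul_comm, ENNReal.ofReal_mul' (hq0 _)]
    · exact ae_of_all _ hq0
    · exact hq.aestronglyMeasurable
    · exact (ae_restrict_iff' hKm).2 <| ae_of_all _ fun x hx => mul_nonneg (hq0 _) (hwpos x hx).le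
    · exact hT.aestronglyMeasurable.mul (hw.aestronglyMeasurable hKm)
  have hgc : Continuous g := hg.continuous
  have hgrad : Continuous (gradient g) := continuous_gradient hg
  have hline : Continuous fun t : ℝ => a' + t • e := by fun_prop
  set G : ℝ → ℝ := fun t => g (a' + t • e) with hG
  set G' : ℝ → ℝ := fun t => ⟪gradient g (a' + t • e), e⟫ with hG'
  have hGd : ∀ t, HasDerivAt G (G' t) t := fun t => by
    have h1 : HasFDerivAt g _ (a' + t • e) :=
      ((hg.differentiable one_ne_zero).differentiableAt.hasGradientAt).hasFDerivAt
    have h2 : HasDerivAt (fun t : ℝ => a' + t • e) e t := by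
      simpa using ((hasDerivAt_id t).smul_const e).const_add a'
    exact h1.comp_hasDerivAt t h2
  have hG'c : Continuous G' := (hgrad.comp hline).inner continuous_const
  have hG'le : ∀ t, |G' t| ≤ ‖gradient g (a' + t • e)‖ := fun t => by
    have := abs_real_inner_le_norm (gradient g (a' + t • e)) e
    rwa [he, mul_one] at this
  refine le_of_forall_pos_le_add fun η hη => ?_
  obtain ⟨c, hc, hle⟩ := poincare_withDensity hp hL hlen hρm hρt hρlc
    (fun s t hs ht => by
      obtain ⟨x, hx, rfl⟩ := hρ0 s hs
      obtain ⟨y, hy, rfl⟩ := hρ0 t ht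
      rw [← inner_sub_left]
      refine (real_inner_le_norm _ _).trans ?_
      rw [he, mul_one, ← dist_eq_norm]
      exact hKd x (hF0 x hx) y (hF0 y hy)) hGd hG'c hM (fun t => hgM _)
    (fun t => (hG'le t).trans (hgM' _)) hη
  have hGcont : Continuous fun t => |G t - c| ^ p :=
    ((hgc.comp hline).sub continuous_const).abs.rpow_const fun _ => Or.inr hp0
  have hG'cont : Continuous fun t => |G' t| ^ p := hG'c.abs.rpow_const fun _ => Or.inr hp0
  rw [← htrans _ hGcont fun t => by positivity, ← htrans _ hG'cont fun t => by positivity] at hle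
  have hTc : Continuous fun x : EuclideanSpace ℝ (Fin (m + 1)) => ⟪x, e⟫ := by fun_prop
  have hb1 : ∀ r, |r| ≤ M → |r - c| ^ p ≤ (2 * M) ^ p := fun r hr => by
    refine Real.rpow_le_rpow (abs_nonneg _) ?_ hp0
    have := abs_le.1 hr
    rw [abs_le]; constructor <;> linarith [hc.1, hc.2, this.1, this.2]
  have i1 : IntegrableOn (fun x => |g x| ^ p * w x) K :=
    hInt _ (hgc.abs.rpow_const fun _ => Or.inr hp0) (M ^ p) fun x => by
      rw [abs_of_nonneg (by positivity)]
      exact Real.rpow_le_rpow (abs_nonneg _) (hgM x) hp0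
  have i2 : IntegrableOn (fun x => |g x - c| ^ p * w x) K :=
    hInt _ ((hgc.sub continuous_const).abs.rpow_const fun _ => Or.inr hp0) ((2 * M) ^ p)
      fun x => by rw [abs_of_nonneg (by positivity)]; exact hb1 _ (hgM x)
  have i3 : IntegrableOn (fun x => signedPow p (g x) * w x) K :=
    hInt _ ((continuous_signedPow hp).comp hgc) (M ^ (p - 1)) fun x => by
      rw [abs_signedPow hp]
      exact Real.rpow_le_rpow (abs_nonneg _) (hgM x) (by linarith)
  have i4 : IntegrableOn (fun x => |G ⟪x, e⟫ - c| ^ p * w x) K :=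
    hInt _ (hGcont.comp hTc) ((2 * M) ^ p)
      fun x => by
        rw [abs_of_nonneg (by positivity)]; exact hb1 _ (hgM _)
  have i5 : IntegrableOn (fun x => ‖gradient g x‖ ^ p * w x) K :=
    hInt _ (hgrad.norm.rpow_const fun _ => Or.inr hp0) (M' ^ p) fun x => by
      rw [abs_of_nonneg (by positivity)]
      exact Real.rpow_le_rpow (norm_nonneg _) (hgM' x) hp0
  have i6 : IntegrableOn (fun x => |G' ⟪x, e⟫| ^ p * w x) K :=
    hInt _ (hG'cont.comp hTc) (M' ^ p)
      fun x => by
        rw [abs_of_nonneg (by positivity)]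
        exact Real.rpow_le_rpow (abs_nonneg _) ((hG'le _).trans (hgM' _)) hp0
  have s1 : ∫ x in K, |g x| ^ p * w x ≤ ∫ x in K, |g x - c| ^ p * w x := by
    have : ∫ x in K, |g x| ^ p * w x - p * c * (signedPow p (g x) * w x) =
        ∫ x in K, |g x| ^ p * w x := by
      rw [integral_sub i1 (i3.const_mul _), integral_const_mul, hzero]; ring
    rw [← this]
    refine setIntegral_mono_on (i1.sub (i3.const_mul _)) i2 hKm fun x hx => ?_
    have := mul_le_mul_of_nonneg_right (abs_rpow_sub_ge hp (g x) c) (hwpos x hx).le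
    linarith
  have s2 : ∫ x in K, |g x - c| ^ p * w x ≤
      (∫ x in K, |G ⟪x, e⟫ - c| ^ p * w x) + ε * ∫ x in K, w x := by
    rw [← integral_const_mul, ← integral_add i4 (hwi.const_mul _)]
    refine setIntegral_mono_on i2 (i4.add (hwi.const_mul _)) hKm fun x hx => ?_
    have h := mul_le_mul_of_nonneg_right (hε1 c hc (a' + ⟪x, e⟫ • e) x
      (by rw [hπ]; exact hδ x hx)) (hwpos x hx).le
    simp only [hG]
    linarith
  have s3 : ∫ x in K, |G' ⟪x, e⟫| ^ p * w x ≤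
      (∫ x in K, ‖gradient g x‖ ^ p * w x) + ε * ∫ x in K, w x := by
    rw [← integral_const_mul, ← integral_add i5 (hwi.const_mul _)]
    refine setIntegral_mono_on i6 (i5.add (hwi.const_mul _)) hKm fun x hx => ?_
    have h := mul_le_mul_of_nonneg_right (((Real.rpow_le_rpow (abs_nonneg _)
      (hG'le ⟪x, e⟫) hp0)).trans (hε2 (a' + ⟪x, e⟫ • e) x
      (by rw [hπ]; exact hδ x hx))) (hwpos x hx).le
    linarith
  have hC : 0 ≤ (L ^ p)⁻¹ := by positivity
  have := mul_le_mul_of_nonneg_left s3 hC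
  linarith

lemma measure_linear_eq_const_eq_zero {E : Type*} [NormedAddCommGroup E] [NormedSpace ℝ E]
    [FiniteDimensional ℝ E] [MeasurableSpace E] [BorelSpace E] (μ : Measure E) [μ.IsAddHaarMeasure]
    {ℓ : E →ₗ[ℝ] ℝ} (hℓ : ℓ ≠ 0) (c : ℝ) : μ {x | ℓ x = c} = 0 := by
  rcases Set.eq_empty_or_nonempty {x | ℓ x = c} with h | ⟨x₀, hx₀⟩
  · rw [h, measure_empty]
  · have hs : {x | ℓ x = c} ⊆ (fun x => x + -x₀) ⁻¹' (LinearMap.ker ℓ : Set E) := fun x hx => by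
      have h1 : ℓ x = c := hx
      have h2 : ℓ x₀ = c := hx₀
      simp [h1, h2]
    refine measure_mono_null hs ?_
    rw [measure_preimage_add_right]
    exact Measure.addHaar_submodule _ _ fun h => hℓ (LinearMap.ker_eq_top.1 h)

/-- The affine functional whose zero set is the line through `(α, β)` with normal
`(cos θ, sin θ)` in the `(i, j)`-coordinate plane. -/
noncomputable def cutForm {n : ℕ} (i j : Fin n) (α β θ : ℝ) (x : EuclideanSpace ℝ (Fin n)) : ℝ :=
  Real.cos θ * (x i - α) + Real.sin θ * (x j - β)

section Bisection

variable {n : ℕ}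

lemma continuous_cutForm (i j : Fin n) (α β θ : ℝ) : Continuous (cutForm i j α β θ) := by
  unfold cutForm; fun_prop

lemma cutForm_add_pi (i j : Fin n) (α β θ : ℝ) (x : EuclideanSpace ℝ (Fin n)) :
    cutForm i j α β (θ + Real.pi) x = -cutForm i j α β θ x := by
  simp [cutForm, Real.cos_add_pi, Real.sin_add_pi]; ring

lemma cutForm_combo (i j : Fin n) (α β θ : ℝ) (x y : EuclideanSpace ℝ (Fin n)) {s t : ℝ}
    (hst : s + t = 1) : cutForm i j α β θ (s • x + t • y) =
      s * cutForm i j α β θ x + t * cutForm i j α β θ y := by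
  simp only [cutForm, PiLp.add_apply, PiLp.smul_apply, smul_eq_mul]
  obtain rfl : t = 1 - s := by linarith
  ring

lemma volume_cutForm_eq_zero {i j : Fin n} (hij : i ≠ j) (α β θ : ℝ) :
    volume {x : EuclideanSpace ℝ (Fin n) | cutForm i j α β θ x = 0} = 0 := by
  set ℓ : EuclideanSpace ℝ (Fin n) →ₗ[ℝ] ℝ :=
    Real.cos θ • (EuclideanSpace.proj i : EuclideanSpace ℝ (Fin n) →L[ℝ] ℝ).toLinearMap +
      Real.sin θ • (EuclideanSpace.proj j : EuclideanSpace ℝ (Fin n) →L[ℝ] ℝ).toLinearMap with hℓ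
  have h0 : ℓ ≠ 0 := by
    intro h
    have h1 := LinearMap.congr_fun h (EuclideanSpace.single i 1)
    have h2 := LinearMap.congr_fun h (EuclideanSpace.single j 1)
    simp [hℓ, hij, hij.symm] at h1 h2
    have := Real.cos_sq_add_sin_sq θ
    rw [h1, h2] at this
    norm_num at this
  refine measure_mono_null (fun x hx => ?_)
    (measure_linear_eq_const_eq_zero volume h0 (Real.cos θ * α + Real.sin θ * β))
  have hx' : cutForm i j α β θ x = 0 := hx
  rw [cutForm] at hx'
  simp only [Set.mem_ofPred_eq, hℓ]
  simp
  linarith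

lemma isOpen_cutForm_pos (i j : Fin n) (α β θ : ℝ) :
    IsOpen {x : EuclideanSpace ℝ (Fin n) | 0 < cutForm i j α β θ x} :=
  isOpen_lt continuous_const (continuous_cutForm _ _ _ _ _)

lemma convex_cutForm_pos (i j : Fin n) (α β θ : ℝ) :
    Convex ℝ {x : EuclideanSpace ℝ (Fin n) | 0 < cutForm i j α β θ x} := by
  refine convex_iff_forall_pos.2 fun x hx y hy s t hs ht hst => ?_
  have hx' : 0 < cutForm i j α β θ x := hx
  have hy' : 0 < cutForm i j α β θ y := hy
  change 0 < cutForm i j α β θ (s • x + t • y)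
  rw [cutForm_combo _ _ _ _ _ _ _ hst]
  positivity

lemma setIntegral_cut_add {i j : Fin n} (hij : i ≠ j) (α β θ : ℝ)
    {K : Set (EuclideanSpace ℝ (Fin n))} (hK : MeasurableSet K)
    {f : EuclideanSpace ℝ (Fin n) → ℝ} (hf : IntegrableOn f K) :
    (∫ x in K ∩ {x | 0 < cutForm i j α β θ x}, f x) +
      ∫ x in K ∩ {x | 0 < cutForm i j α β (θ + Real.pi) x}, f x = ∫ x in K, f x := by
  have m1 := (isOpen_cutForm_pos i j α β θ).measurableSet
  have m2 := (isOpen_cutForm_pos i j α β (θ + Real.pi)).measurableSet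
  rw [← setIntegral_union _ (hK.inter m2) (hf.mono_set Set.inter_subset_left)
    (hf.mono_set Set.inter_subset_left)]
  · refine setIntegral_congr_set ?_
    have h0 : ∀ᵐ x : EuclideanSpace ℝ (Fin n), ¬ cutForm i j α β θ x = 0 := by
      rw [ae_iff]; simpa using volume_cutForm_eq_zero hij α β θ
    filter_upwards [h0] with x hx
    refine propext ⟨?_, fun h => ?_⟩
    · rintro (h | h) <;> exact h.1
    · rcases lt_or_gt_of_ne hx with h' | h'
      · refine Or.inr ⟨h, ?_⟩
        change 0 < cutForm i j α β (θ + Real.pi) x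
        rw [cutForm_add_pi]; linarith
      · exact Or.inl ⟨h, h'⟩
  · refine Set.disjoint_left.2 fun x hx hx' => ?_
    have h1 : 0 < cutForm i j α β θ x := hx.2
    have h2 : 0 < cutForm i j α β (θ + Real.pi) x := hx'.2
    rw [cutForm_add_pi] at h2
    linarith

lemma continuous_setIntegral_cut {i j : Fin n} (hij : i ≠ j) (α β : ℝ)
    {K : Set (EuclideanSpace ℝ (Fin n))}
    {f : EuclideanSpace ℝ (Fin n) → ℝ} (hf : IntegrableOn f K) :
    Continuous fun θ => ∫ x in K ∩ {x | 0 < cutForm i j α β θ x}, f x := by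
  have e : ∀ θ, ∫ x in K ∩ {x | 0 < cutForm i j α β θ x}, f x =
      ∫ x in K, {x | 0 < cutForm i j α β θ x}.indicator f x := fun θ => by
    rw [setIntegral_indicator (isOpen_cutForm_pos i j α β θ).measurableSet]
  simp only [e]
  refine continuous_iff_continuousAt.2 fun θ₀ => ?_
  refine continuousAt_of_dominated (bound := fun x => ‖f x‖) ?_ ?_ hf.norm ?_
  · exact Eventually.of_forall fun θ =>
      hf.aestronglyMeasurable.indicator (isOpen_cutForm_pos i j α β θ).measurableSet
  · exact Eventually.of_forall fun θ => ae_of_all _ fun x => norm_indicator_le_norm_self _ _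
  · have h0 : ∀ᵐ x : EuclideanSpace ℝ (Fin n), ¬ cutForm i j α β θ₀ x = 0 := by
      rw [ae_iff]; simpa using volume_cutForm_eq_zero hij α β θ₀
    filter_upwards [ae_restrict_of_ae h0] with x hx
    have hc : Continuous fun θ => cutForm i j α β θ x := by unfold cutForm; fun_prop
    rcases lt_or_gt_of_ne hx with h' | h'
    · have hev : ∀ᶠ θ in nhds θ₀, cutForm i j α β θ x < 0 := hc.continuousAt.eventually_lt_const h'
      refine (continuousAt_const (y := (0 : ℝ))).congr ?_
      filter_upwards [hev] with θ hθ
      rw [Set.indicator_of_notMem]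
      exact fun h => lt_asymm hθ h
    · have hev : ∀ᶠ θ in nhds θ₀, 0 < cutForm i j α β θ x := hc.continuousAt.eventually_const_lt h'
      refine (continuousAt_const (y := f x)).congr ?_
      filter_upwards [hev] with θ hθ
      rw [Set.indicator_of_mem]
      exact hθ

/-- A convex body can be cut through a prescribed codimension-two plane so that one half keeps the
balance of `f` and the positivity of `h`. -/
lemma exists_cut {i j : Fin n} (hij : i ≠ j) (α β : ℝ)
    {K : Set (EuclideanSpace ℝ (Fin n))} (hK : MeasurableSet K)
    {f h : EuclideanSpace ℝ (Fin n) → ℝ} (hf : IntegrableOn f K) (hh : IntegrableOn h K)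
    (hf0 : ∫ x in K, f x = 0) (hh0 : 0 < ∫ x in K, h x) :
    ∃ θ, ∫ x in K ∩ {x | 0 < cutForm i j α β θ x}, f x = 0 ∧
      0 < ∫ x in K ∩ {x | 0 < cutForm i j α β θ x}, h x := by
  have hc := continuous_setIntegral_cut hij α β hf
  have hadd := fun θ => setIntegral_cut_add hij α β θ hK hf
  obtain ⟨θ, hθ⟩ : (0 : ℝ) ∈ Set.range fun θ =>
      ∫ x in K ∩ {x | 0 < cutForm i j α β θ x}, f x := by
    have h0 := hadd 0
    rw [hf0] at h0
    rcases le_total (∫ x in K ∩ {x | 0 < cutForm i j α β 0 x}, f x) 0 with h | h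
    · exact mem_range_of_exists_le_of_exists_ge hc ⟨0, h⟩ ⟨0 + Real.pi, by linarith⟩
    · exact mem_range_of_exists_le_of_exists_ge hc ⟨0 + Real.pi, by linarith⟩ ⟨0, h⟩
  simp only at hθ
  have h1 := hadd θ
  rw [hθ, hf0, zero_add] at h1
  have h2 := setIntegral_cut_add hij α β θ hK hh
  rcases lt_or_ge 0 (∫ x in K ∩ {x | 0 < cutForm i j α β θ x}, h x) with h | h
  · exact ⟨θ, hθ, h⟩
  · exact ⟨θ + Real.pi, h1, by linarith⟩

end Bisection

lemma exists_cut_sequence {n : ℕ} (hn : 2 ≤ n) {Ω : Set (EuclideanSpace ℝ (Fin n))}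
    (hΩo : IsOpen Ω) (hΩc : Convex ℝ Ω) {f h : EuclideanSpace ℝ (Fin n) → ℝ}
    (hf : IntegrableOn f Ω) (hh : IntegrableOn h Ω)
    (hf0 : ∫ x in Ω, f x = 0) (hh0 : 0 < ∫ x in Ω, h x) :
    ∃ K : ℕ → Set (EuclideanSpace ℝ (Fin n)), Antitone K ∧
      (∀ k, K k ⊆ Ω ∧ IsOpen (K k) ∧ Convex ℝ (K k) ∧ ∫ x in K k, f x = 0 ∧
        0 < ∫ x in K k, h x) ∧
      ∀ i j : Fin n, i ≠ j → ∀ α β : ℚ, ∃ k θ, K k ⊆ {x | 0 < cutForm i j α β θ x} := by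
  set Good : Set (EuclideanSpace ℝ (Fin n)) → Prop := fun K =>
    K ⊆ Ω ∧ IsOpen K ∧ Convex ℝ K ∧ ∫ x in K, f x = 0 ∧ 0 < ∫ x in K, h x with hGood
  have step : ∀ (K : {K // Good K}) (q : (Fin n × Fin n) × ℚ × ℚ), ∃ K' : {K // Good K},
      K'.1 ⊆ K.1 ∧ (q.1.1 ≠ q.1.2 → ∃ θ,
        K'.1 ⊆ {x | 0 < cutForm q.1.1 q.1.2 (q.2.1 : ℝ) (q.2.2 : ℝ) θ x}) := by
    rintro ⟨K, hK⟩ ⟨⟨i, j⟩, α, β⟩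
    by_cases hij : i = j
    · exact ⟨⟨K, hK⟩, subset_rfl, fun h => (h hij).elim⟩
    · obtain ⟨hKΩ, hKo, hKc, hKf, hKh⟩ := hK
      obtain ⟨θ, h1, h2⟩ := exists_cut hij α β hKo.measurableSet (hf.mono_set hKΩ)
        (hh.mono_set hKΩ) hKf hKh
      exact ⟨⟨_, Set.inter_subset_left.trans hKΩ, hKo.inter (isOpen_cutForm_pos i j α β θ),
        hKc.inter (convex_cutForm_pos i j α β θ), h1, h2⟩, Set.inter_subset_left,
        fun _ => ⟨θ, Set.inter_subset_right⟩⟩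
  choose next hnext hnext' using step
  have : Nonempty (Fin n) := ⟨⟨0, by omega⟩⟩
  obtain ⟨q, hq⟩ := exists_surjective_nat ((Fin n × Fin n) × ℚ × ℚ)
  set K : ℕ → {K // Good K} := fun k =>
    Nat.rec ⟨Ω, subset_rfl, hΩo, hΩc, hf0, hh0⟩ (fun k K => next K (q k)) k with hK
  refine ⟨fun k => (K k).1, antitone_nat_of_succ_le fun k => hnext (K k) (q k),
    fun k => (K k).2, fun i j hij α β => ?_⟩
  obtain ⟨k, hk⟩ := hq ((i, j), α, β)
  have h1 := hnext' (K k) (q k)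
  rw [hk] at h1
  obtain ⟨θ, hθ⟩ := h1 hij
  refine ⟨k + 1, θ, ?_⟩
  change (next (K k) (q k)).1 ⊆ _
  rw [hk]
  exact hθ

/-- If every rational point of the `(i, j)`-plane is separated from `S` by a weakly supporting
line, then the projection of `S` to that plane is degenerate. -/
lemma minor_eq_of_forall_cut {n : ℕ} {i j : Fin n} {S : Set (EuclideanSpace ℝ (Fin n))}
    (hS : ∀ α β : ℚ, ∃ θ, ∀ x ∈ S, 0 ≤ cutForm i j α β θ x)
    {a b c : EuclideanSpace ℝ (Fin n)} (ha : a ∈ S) (hb : b ∈ S) (hc : c ∈ S) :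
    (b i - a i) * (c j - a j) = (b j - a j) * (c i - a i) := by
  by_contra hne
  set D := (b i - a i) * (c j - a j) - (b j - a j) * (c i - a i) with hD
  have hD0 : D ≠ 0 := sub_ne_zero.2 hne
  set σ : ℝ × ℝ → ℝ := fun z => ((z.1 - a i) * (c j - a j) - (z.2 - a j) * (c i - a i)) / D with hσ
  set τ : ℝ × ℝ → ℝ := fun z => ((b i - a i) * (z.2 - a j) - (b j - a j) * (z.1 - a i)) / D with hτ
  have hσc : Continuous σ := by fun_prop
  have hτc : Continuous τ := by fun_prop
  have hopen : IsOpen {z | 0 < σ z ∧ 0 < τ z ∧ σ z + τ z < 1} :=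
    (isOpen_lt continuous_const hσc).inter ((isOpen_lt continuous_const hτc).inter
      (isOpen_lt (hσc.add hτc) continuous_const))
  obtain ⟨⟨α, β⟩, h1, h2, h3⟩ := ((Rat.denseRange_cast (𝕜 := ℝ)).prodMap
      (Rat.denseRange_cast (𝕜 := ℝ))).exists_mem_open hopen
    ⟨(a i + (b i - a i) / 3 + (c i - a i) / 3, a j + (b j - a j) / 3 + (c j - a j) / 3), by
      have e1 : σ (a i + (b i - a i) / 3 + (c i - a i) / 3,
          a j + (b j - a j) / 3 + (c j - a j) / 3) = 1 / 3 := by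
        simp only [hσ]; rw [div_eq_iff hD0, hD]; ring
      have e2 : τ (a i + (b i - a i) / 3 + (c i - a i) / 3,
          a j + (b j - a j) / 3 + (c j - a j) / 3) = 1 / 3 := by
        simp only [hτ]; rw [div_eq_iff hD0, hD]; ring
      simp only [Set.mem_ofPred_eq]
      rw [e1, e2]; norm_num⟩
  obtain ⟨θ, hθ⟩ := hS α β
  simp only [Prod.map_apply] at h1 h2 h3
  set s := σ ((α : ℝ), (β : ℝ)) with hs
  set t := τ ((α : ℝ), (β : ℝ)) with ht
  have hα : (α : ℝ) = a i + s * (b i - a i) + t * (c i - a i) := by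
    rw [hs, ht, hσ, hτ]
    field_simp
    rw [hD]; ring
  have hβ : (β : ℝ) = a j + s * (b j - a j) + t * (c j - a j) := by
    rw [hs, ht, hσ, hτ]
    field_simp
    rw [hD]; ring
  have pa := hθ a ha
  have pb := hθ b hb
  have pc := hθ c hc
  have hsum : (1 - s - t) * cutForm i j α β θ a + s * cutForm i j α β θ b +
      t * cutForm i j α β θ c = 0 := by
    simp only [cutForm]; rw [hα, hβ]; ring
  have qa : 0 ≤ (1 - s - t) * cutForm i j α β θ a := mul_nonneg (by linarith) pa
  have qb := mul_nonneg h1.le pb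
  have qc := mul_nonneg h2.le pc
  have za : cutForm i j α β θ a = 0 :=
    (mul_eq_zero.1 (by linarith : (1 - s - t) * cutForm i j α β θ a = 0)).resolve_left
      (by linarith)
  have zb : cutForm i j α β θ b = 0 :=
    (mul_eq_zero.1 (by linarith : s * cutForm i j α β θ b = 0)).resolve_left h1.ne'
  have zc : cutForm i j α β θ c = 0 :=
    (mul_eq_zero.1 (by linarith : t * cutForm i j α β θ c = 0)).resolve_left h2.ne'
  have zu : Real.cos θ * (b i - a i) + Real.sin θ * (b j - a j) = 0 := by
    simp only [cutForm] at za zb; linarith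
  have zv : Real.cos θ * (c i - a i) + Real.sin θ * (c j - a j) = 0 := by
    simp only [cutForm] at za zc; linarith
  have c0 : Real.cos θ * D = 0 := by
    rw [hD]; linear_combination (c j - a j) * zu - (b j - a j) * zv
  have s0 : Real.sin θ * D = 0 := by
    rw [hD]; linear_combination (b i - a i) * zv - (c i - a i) * zu
  have := Real.cos_sq_add_sin_sq θ
  rw [(mul_eq_zero.1 c0).resolve_right hD0, (mul_eq_zero.1 s0).resolve_right hD0] at this
  norm_num at this

lemma exists_line_of_minors {n : ℕ} (hn : 0 < n) {S : Set (EuclideanSpace ℝ (Fin n))}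
    {a : EuclideanSpace ℝ (Fin n)} (hS : ∀ b ∈ S, ∀ c ∈ S, ∀ i j,
      (b i - a i) * (c j - a j) = (b j - a j) * (c i - a i)) :
    ∃ e : EuclideanSpace ℝ (Fin n), ‖e‖ = 1 ∧ ∀ c ∈ S, c - a = ⟪c - a, e⟫ • e := by
  by_cases h : ∀ c ∈ S, c = a
  · exact ⟨EuclideanSpace.single ⟨0, hn⟩ 1, by simp, fun c hc => by simp [h c hc]⟩
  · push Not at h
    obtain ⟨b, hb, hba⟩ := h
    have hu : ‖b - a‖ ≠ 0 := norm_ne_zero_iff.2 (sub_ne_zero.2 hba)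
    refine ⟨‖b - a‖⁻¹ • (b - a), by rw [norm_smul, norm_inv, norm_norm, inv_mul_cancel₀ hu],
      fun c hc => ?_⟩
    have key : ⟪c - a, b - a⟫ • (b - a) = (‖b - a‖ ^ 2) • (c - a) := by
      ext i
      simp only [PiLp.smul_apply, smul_eq_mul, PiLp.sub_apply]
      rw [EuclideanSpace.real_norm_sq_eq, PiLp.inner_apply, Finset.sum_mul, Finset.sum_mul]
      refine Finset.sum_congr rfl fun j _ => ?_
      simp only [PiLp.sub_apply, RCLike.inner_apply, conj_trivial]
      linear_combination (b j - a j) * hS b hb c hc i j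
    rw [inner_smul_right, smul_smul, mul_right_comm, ← smul_smul, key,
      smul_smul]
    field_simp
    simp

lemma norm_sub_inner_smul_le {E : Type*} [NormedAddCommGroup E] [InnerProductSpace ℝ E] {e : E}
    (he : ‖e‖ = 1) (y : E) : ‖y - ⟪y, e⟫ • e‖ ≤ ‖y‖ := by
  have h : ‖y - ⟪y, e⟫ • e‖ ^ 2 ≤ ‖y‖ ^ 2 := by
    rw [norm_sub_sq_real, inner_smul_right, norm_smul, he]
    simp only [Real.norm_eq_abs, mul_one, sq_abs]
    nlinarith [sq_nonneg ⟪y, e⟫]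
  exact le_of_sq_le_sq h (norm_nonneg _)

/-- Bisection of a convex body into a piece that lies near a line, keeping the balance of `f` and
the positivity of `h`. -/
lemma exists_thin_piece {n : ℕ} (hn : 2 ≤ n) {Ω : Set (EuclideanSpace ℝ (Fin n))}
    (hΩo : IsOpen Ω) (hΩb : Bornology.IsBounded Ω) (hΩc : Convex ℝ Ω)
    {f h : EuclideanSpace ℝ (Fin n) → ℝ}
    (hf : IntegrableOn f Ω) (hh : IntegrableOn h Ω)
    (hf0 : ∫ x in Ω, f x = 0) (hh0 : 0 < ∫ x in Ω, h x) {δ : ℝ} (hδ : 0 < δ) :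
    ∃ K ⊆ Ω, IsOpen K ∧ Convex ℝ K ∧ (∫ x in K, f x = 0) ∧ (0 < ∫ x in K, h x) ∧
      ∃ a e : EuclideanSpace ℝ (Fin n), ‖e‖ = 1 ∧
        ∀ x ∈ K, dist (a + ⟪x - a, e⟫ • e) x ≤ δ := by
  obtain ⟨K, hKanti, hK, hcut⟩ := exists_cut_sequence hn hΩo hΩc hf hh hf0 hh0
  have hne : ∀ k, (K k).Nonempty := fun k => by
    by_contra h0
    rw [Set.not_nonempty_iff_eq_empty] at h0
    have := (hK k).2.2.2.2
    simp [h0] at this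
  have hcpt : ∀ k, IsCompact (closure (K k)) := fun k => (hΩb.subset (hK k).1).isCompact_closure
  set S := ⋂ k, closure (K k) with hS
  obtain ⟨a, ha⟩ : S.Nonempty :=
    IsCompact.nonempty_iInter_of_sequence_nonempty_isCompact_isClosed _
      (fun k => closure_mono (hKanti (Nat.le_succ k))) (fun k => (hne k).closure) (hcpt 0)
      fun k => isClosed_closure
  have hsep : ∀ i j : Fin n, i ≠ j → ∀ α β : ℚ, ∃ θ, ∀ x ∈ S, 0 ≤ cutForm i j α β θ x := by
    intro i j hij α β
    obtain ⟨k, θ, hk⟩ := hcut i j hij α β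
    refine ⟨θ, fun x hx => ?_⟩
    have hcl : IsClosed {x : EuclideanSpace ℝ (Fin n) | 0 ≤ cutForm i j α β θ x} :=
      isClosed_le continuous_const (continuous_cutForm _ _ _ _ _)
    have hx' : x ∈ closure (K k) := Set.mem_iInter.1 hx k
    refine closure_minimal (fun y hy => ?_) hcl hx'
    have : 0 < cutForm i j α β θ y := hk hy
    exact this.le
  obtain ⟨e, he, hline⟩ := exists_line_of_minors (a := a) (S := S) (by omega) fun b hb c hc i j => by
    rcases eq_or_ne i j with rfl | hij
    · rfl
    · exact minor_eq_of_forall_cut (hsep i j hij) ha hb hc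
  obtain ⟨k, hk⟩ := exists_subset_nhds_of_isCompact (V := fun k => closure (K k))
    (directed_of_isDirected_le fun _ _ hij => closure_mono (hKanti hij)) hcpt
    (U := Metric.thickening δ S) fun x hx => Metric.isOpen_thickening.mem_nhds
      (Metric.self_subset_thickening hδ S hx)
  refine ⟨K k, (hK k).1, (hK k).2.1, (hK k).2.2.1, (hK k).2.2.2.1, (hK k).2.2.2.2, a, e, he,
    fun x hx => ?_⟩
  obtain ⟨c, hc, hxc⟩ := Metric.mem_thickening_iff.1 (hk (subset_closure hx))
  rw [dist_comm, dist_eq_norm]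
  have h1 : x - (a + ⟪x - a, e⟫ • e) = (x - c) - ⟪x - c, e⟫ • e := by
    have h2 : x - a = (x - c) + (c - a) := by abel
    have h3 := hline c hc
    rw [h2, inner_add_left, add_smul, ← h3]
    abel
  rw [h1]
  exact (norm_sub_inner_smul_le he _).trans (by rw [← dist_eq_norm]; exact hxc.le)

lemma exists_delta_abs_sub_rpow {E : Type*} [PseudoMetricSpace E] {p : ℝ} (hp : 0 ≤ p) {g : E → ℝ}
    (hg : UniformContinuous g) {M : ℝ} (hgM : ∀ x, |g x| ≤ M) {ε : ℝ} (hε : 0 < ε) :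
    ∃ δ > 0, ∀ c ∈ Set.Icc (-M) M, ∀ x y, dist x y < δ → |g y - c| ^ p ≤ |g x - c| ^ p + ε := by
  have hq : Continuous fun r : ℝ => |r| ^ p := continuous_abs.rpow_const fun _ => Or.inr hp
  have hu := (isCompact_Icc (a := -(2 * M)) (b := 2 * M)).uniformContinuousOn_of_continuous
    hq.continuousOn
  obtain ⟨δ₁, hδ₁, h1⟩ := Metric.uniformContinuousOn_iff.1 hu ε hε
  obtain ⟨δ, hδ, h2⟩ := Metric.uniformContinuous_iff.1 hg δ₁ hδ₁
  refine ⟨δ, hδ, fun c hc x y hxy => ?_⟩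
  have hmem : ∀ z, g z - c ∈ Set.Icc (-(2 * M)) (2 * M) := fun z => by
    have := abs_le.1 (hgM z)
    constructor <;> linarith [hc.1, hc.2, this.1, this.2]
  have h3 := h1 _ (hmem x) _ (hmem y) (by rw [dist_sub_right]; exact h2 hxy)
  rw [Real.dist_eq] at h3
  have := abs_lt.1 h3
  linarith [this.1]

/-- The weighted Poincaré inequality on a bounded convex domain with a log-concave weight. -/
lemma poincare_logConcave_weight {n : ℕ} (hn : 2 ≤ n) {p : ℝ} (hp : 2 ≤ p)
    {Ω : Set (EuclideanSpace ℝ (Fin n))}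
    (hΩo : IsOpen Ω) (hΩb : Bornology.IsBounded Ω) (hΩc : Convex ℝ Ω) {L : ℝ} (hL : 0 < L)
    (hlen : Metric.diam Ω * L < piP p)
    {w : EuclideanSpace ℝ (Fin n) → ℝ} (hw : ContinuousOn w Ω) (hwpos : ∀ x ∈ Ω, 0 < w x)
    {B : ℝ} (hwB : ∀ x ∈ Ω, w x ≤ B)
    (hwlc : ∀ x ∈ Ω, ∀ y ∈ Ω, ∀ s t : ℝ, 0 < s → 0 < t → s + t = 1 →
      w x ^ s * w y ^ t ≤ w (s • x + t • y))
    {f : EuclideanSpace ℝ (Fin n) → ℝ} (hf : ContDiff ℝ 1 f) (hfc : HasCompactSupport f) :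
    ∃ c, ∫ x in Ω, |f x - c| ^ p * w x ≤ (L ^ p)⁻¹ * ∫ x in Ω, ‖gradient f x‖ ^ p * w x := by
  obtain ⟨m, rfl⟩ : ∃ m, n = m + 1 := ⟨n - 1, by omega⟩
  have hp0 : 0 < p := by linarith
  obtain ⟨M, hfM⟩ := hfc.exists_bound_of_continuous hf.continuous
  have hM : 0 ≤ M := (norm_nonneg _).trans (hfM 0)
  have hgc : HasCompactSupport (gradient f) :=
    hfc.of_isClosed_subset (isClosed_tsupport _) (tsupport_gradient_subset f)
  have hgcont := continuous_gradient hf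
  obtain ⟨M', hM'⟩ := hgc.exists_bound_of_continuous hgcont
  have hM'0 : 0 ≤ M' := (norm_nonneg _).trans (hM' 0)
  have hΩm := hΩo.measurableSet
  have hwi : IntegrableOn w Ω :=
    IntegrableOn.of_bound hΩb.measure_lt_top (hw.aestronglyMeasurable hΩm) B <|
      (ae_restrict_iff' hΩm).2 <| ae_of_all _ fun x hx => by
        rw [Real.norm_of_nonneg (hwpos x hx).le]; exact hwB x hx
  have : IsFiniteMeasure ((volume.restrict Ω).withDensity fun x => ENNReal.ofReal (w x)) :=
    isFiniteMeasure_withDensity_ofReal hwi.2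
  obtain ⟨c, hc, hc0⟩ := exists_integral_signedPow_sub_eq_zero
    ((volume.restrict Ω).withDensity fun x => ENNReal.ofReal (w x)) hp
    hf.continuous.aestronglyMeasurable hM hfM
  rw [integral_withDensity_eq_integral_toReal_smul₀
    (hw.aestronglyMeasurable hΩm).aemeasurable.ennreal_ofReal
    (ae_of_all _ fun x => ENNReal.ofReal_lt_top)] at hc0
  set g := fun x => f x - c with hg
  have hgC : ContDiff ℝ 1 g := hf.sub contDiff_const
  have hgrad : gradient g = gradient f := by
    funext x
    simp only [gradient, hg]
    rw [fderiv_sub_const]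
  have hg0 : ∫ x in Ω, signedPow p (g x) * w x = 0 := by
    rw [← hc0]
    refine setIntegral_congr_fun hΩm fun x hx => ?_
    simp only [smul_eq_mul]
    rw [ENNReal.toReal_ofReal (hwpos x hx).le, mul_comm]
  have hgM : ∀ x, |g x| ≤ 2 * M := fun x => by
    have := abs_le.1 (hfM x)
    rw [abs_le]; constructor <;> simp only [hg] <;> linarith [hc.1, hc.2, this.1, this.2]
  have hfu : UniformContinuous f := hfc.uniformContinuous_of_continuous hf.continuous
  have hgu : UniformContinuous g := hfu.sub uniformContinuous_const
  have hInt : ∀ q : EuclideanSpace ℝ (Fin (m + 1)) → ℝ, Continuous q → ∀ D, (∀ x, |q x| ≤ D) →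
      IntegrableOn (fun x => q x * w x) Ω := fun q hq D hD =>
    Integrable.bdd_mul (c := D) hwi hq.aestronglyMeasurable (ae_of_all _ hD)
  have i1 : IntegrableOn (fun x => |g x| ^ p * w x) Ω :=
    hInt _ (hgC.continuous.abs.rpow_const fun _ => Or.inr hp0.le) ((2 * M) ^ p) fun x => by
      rw [abs_of_nonneg (by positivity)]
      exact Real.rpow_le_rpow (abs_nonneg _) (hgM x) hp0.le
  have i2 : IntegrableOn (fun x => ‖gradient g x‖ ^ p * w x) Ω := by
    rw [hgrad]
    exact hInt _ (hgcont.norm.rpow_const fun _ => Or.inr hp0.le) (M' ^ p) fun x => by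
      rw [abs_of_nonneg (by positivity)]
      exact Real.rpow_le_rpow (norm_nonneg _) (hM' x) hp0.le
  have i3 : IntegrableOn (fun x => signedPow p (g x) * w x) Ω :=
    hInt _ ((continuous_signedPow hp).comp hgC.continuous) ((2 * M) ^ (p - 1)) fun x => by
      rw [abs_signedPow hp]
      exact Real.rpow_le_rpow (abs_nonneg _) (hgM x) (by linarith)
  refine ⟨c, ?_⟩
  rw [← hgrad]
  change ∫ x in Ω, |g x| ^ p * w x ≤ _
  set C := (L ^ p)⁻¹ with hC
  have hC0 : 0 ≤ C := by positivity
  by_contra! hlt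
  set W := ∫ x in Ω, w x with hW
  have hW0 : 0 ≤ W := setIntegral_nonneg hΩm fun x hx => (hwpos x hx).le
  obtain ⟨κ, hκ, hκW⟩ : ∃ κ > 0, κ * W <
      (∫ x in Ω, |g x| ^ p * w x) - C * ∫ x in Ω, ‖gradient g x‖ ^ p * w x := by
    set η := (∫ x in Ω, |g x| ^ p * w x) - C * ∫ x in Ω, ‖gradient g x‖ ^ p * w x with hη
    have hη0 : 0 < η := sub_pos.2 hlt
    refine ⟨η / (W + 1), by positivity, ?_⟩
    rw [div_mul_eq_mul_div, div_lt_iff₀ (by positivity)]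
    nlinarith
  set ε := κ / (C + 1) with hε
  have hε0 : 0 < ε := by positivity
  obtain ⟨δ₁, hδ₁, h1⟩ := exists_delta_abs_sub_rpow hp0.le hgu hgM hε0
  obtain ⟨δ₂, hδ₂, h2⟩ : ∃ δ > 0, ∀ x y, dist x y < δ →
      ‖gradient g x‖ ^ p ≤ ‖gradient g y‖ ^ p + ε := by
    have hu : UniformContinuous (gradient g) := by
      rw [hgrad]; exact hgc.uniformContinuous_of_continuous hgcont
    have hun : UniformContinuous fun x => ‖gradient g x‖ := uniformContinuous_norm.comp hu
    obtain ⟨δ, hδ, h⟩ := exists_delta_abs_sub_rpow hp0.le hun (M := M')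
      (fun x => by rw [abs_of_nonneg (norm_nonneg _), hgrad]; exact hM' x) hε0
    refine ⟨δ, hδ, fun x y hxy => ?_⟩
    have := h 0 ⟨by linarith, hM'0⟩ y x (by rwa [dist_comm])
    simpa using this
  have hhi : IntegrableOn (fun x => |g x| ^ p * w x - C * (‖gradient g x‖ ^ p * w x) - κ * w x) Ω :=
    (i1.sub (i2.const_mul C)).sub (hwi.const_mul κ)
  have hsplit : ∀ K ⊆ Ω,
      ∫ x in K, (|g x| ^ p * w x - C * (‖gradient g x‖ ^ p * w x) - κ * w x) =
      (∫ x in K, |g x| ^ p * w x) - C * (∫ x in K, ‖gradient g x‖ ^ p * w x) -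
        κ * ∫ x in K, w x := fun K hK => by
    have h12 : IntegrableOn (fun x => |g x| ^ p * w x - C * (‖gradient g x‖ ^ p * w x)) K :=
      (i1.mono_set hK).sub ((i2.mono_set hK).const_mul C)
    rw [integral_sub h12 ((hwi.mono_set hK).const_mul κ), integral_sub (i1.mono_set hK) ((i2.mono_set hK).const_mul C),
      integral_const_mul, integral_const_mul]
  obtain ⟨R, hR⟩ := hΩb.exists_norm_le
  obtain ⟨K, hKΩ, hKo, hKc, hK0, hKh, a, e, he, hae⟩ := exists_thin_piece hn hΩo hΩb hΩc i3 hhi hg0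
    (by rw [hsplit Ω subset_rfl]; linarith) (half_pos (lt_min hδ₁ hδ₂))
  have hlt2 : ∀ {r : ℝ}, r ≤ min δ₁ δ₂ / 2 → r < min δ₁ δ₂ := fun hr =>
    lt_of_le_of_lt hr (half_lt_self (lt_min hδ₁ hδ₂))
  have hfinal := poincare_of_near_line hp hL hlen hKo.measurableSet hKc
    (fun x hx => hR x (hKΩ hx))
    (fun x hx y hy => Metric.dist_le_diam_of_mem hΩb (hKΩ hx) (hKΩ hy)) (hw.mono hKΩ)
    (fun x hx => hwpos x (hKΩ hx)) (fun x hx => hwB x (hKΩ hx))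
    (fun x hx y hy => hwlc x (hKΩ hx) y (hKΩ hy)) he hae hgC hgM
    (fun x => by rw [hgrad]; exact hM' x)
    (fun c hc x y hxy => h1 c hc x y ((hlt2 hxy).trans_le (min_le_left _ _)))
    (fun x y hxy => h2 x y ((hlt2 hxy).trans_le (min_le_right _ _))) hK0
  rw [hsplit K hKΩ] at hKh
  have hκε : (C + 1) * ε = κ := by rw [hε]; field_simp
  rw [hκε] at hfinal
  linarith

lemma norm_add_rpow_le {F : Type*} [SeminormedAddCommGroup F] {p : ℝ} (hp : 1 ≤ p) {t : ℝ}
    (ht : t ∈ Set.Ioo (0 : ℝ) 1) (x y : F) :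
    ‖x + y‖ ^ p ≤ (1 - t) ^ (1 - p) * ‖x‖ ^ p + t ^ (1 - p) * ‖y‖ ^ p := by
  have ht0 := ht.1
  have ht1 : 0 < 1 - t := by linarith [ht.2]
  have hconv := (convexOn_rpow hp).2 (show 0 ≤ ‖x‖ / (1 - t) by positivity)
    (show 0 ≤ ‖y‖ / t by positivity) ht1.le ht0.le (by ring)
  simp only [smul_eq_mul] at hconv
  rw [mul_div_cancel₀ _ ht1.ne', mul_div_cancel₀ _ ht0.ne',
    Real.div_rpow (norm_nonneg _) ht1.le, Real.div_rpow (norm_nonneg _) ht0.le] at hconv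
  calc ‖x + y‖ ^ p ≤ (‖x‖ + ‖y‖) ^ p :=
        Real.rpow_le_rpow (norm_nonneg _) (norm_add_le _ _) (by linarith)
    _ ≤ _ := hconv
    _ = _ := by
      rw [Real.rpow_sub ht1, Real.rpow_sub ht0, Real.rpow_one, Real.rpow_one]
      ring

lemma integral_norm_add_rpow_le {X F : Type*} [MeasurableSpace X] {μ : Measure X}
    [SeminormedAddCommGroup F] {p : ℝ} (hp : 1 ≤ p) {f g : X → F}
    (hf : Integrable (fun x => ‖f x‖ ^ p) μ) (hg : Integrable (fun x => ‖g x‖ ^ p) μ) {t : ℝ}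
    (ht : t ∈ Set.Ioo (0 : ℝ) 1) :
    ∫ x, ‖f x + g x‖ ^ p ∂μ ≤
      (1 - t) ^ (1 - p) * (∫ x, ‖f x‖ ^ p ∂μ) + t ^ (1 - p) * ∫ x, ‖g x‖ ^ p ∂μ := by
  rw [← integral_const_mul, ← integral_const_mul,
    ← integral_add (hf.const_mul _) (hg.const_mul _)]
  exact integral_mono_of_nonneg (ae_of_all _ fun x => by positivity)
    ((hf.const_mul _).add (hg.const_mul _)) (ae_of_all _ fun x => norm_add_rpow_le hp ht _ _)

lemma integrable_norm_sub_rpow {X F : Type*} [MeasurableSpace X] {μ : Measure X}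
    [NormedAddCommGroup F] {p : ℝ} (hp : 1 ≤ p) {f g : X → F}
    (hfm : AEStronglyMeasurable f μ) (hgm : AEStronglyMeasurable g μ)
    (hf : Integrable (fun x => ‖f x‖ ^ p) μ) (hg : Integrable (fun x => ‖g x‖ ^ p) μ) :
    Integrable (fun x => ‖f x - g x‖ ^ p) μ := by
  have hm : AEStronglyMeasurable (fun x => ‖f x - g x‖ ^ p) μ :=
    ((continuous_id.rpow_const fun _ => Or.inr (by linarith)).comp_aestronglyMeasurable
      (hfm.sub hgm).norm)
  refine Integrable.mono' ((hf.const_mul ((1 - 1 / 2 : ℝ) ^ (1 - p))).add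
    (hg.const_mul ((1 / 2 : ℝ) ^ (1 - p)))) hm (ae_of_all _ fun x => ?_)
  rw [Real.norm_of_nonneg (by positivity), sub_eq_add_neg]
  have := norm_add_rpow_le hp (t := 1 / 2) ⟨by norm_num, by norm_num⟩ (f x) (-g x)
  rwa [norm_neg] at this

/-- The stability inequality for smooth compactly supported functions. -/
lemma gap_stability {n : ℕ} (hn : 2 ≤ n) {p : ℝ} (hp : 2 ≤ p)
    {Ω : Set (EuclideanSpace ℝ (Fin n))}
    (hΩo : IsOpen Ω) (hΩb : Bornology.IsBounded Ω) (hΩc : Convex ℝ Ω)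
    {u : EuclideanSpace ℝ (Fin n) → ℝ} (huC : ContDiffOn ℝ 1 u Ω) (hpos : ∀ x ∈ Ω, 0 < u x)
    {B : ℝ} (huB : ∀ x ∈ Ω, u x ≤ B) {lam : ℝ}
    (hweak : ∀ φ : EuclideanSpace ℝ (Fin n) → ℝ,
      ContDiff ℝ (⊤ : ℕ∞) φ → HasCompactSupport φ → tsupport φ ⊆ Ω →
      ∫ x in Ω, ‖gradient u x‖ ^ (p - 2) * ⟪gradient u x, gradient φ x⟫
        = lam * ∫ x in Ω, |u x| ^ (p - 2) * u x * φ x)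
    (hlc : ConcaveOn ℝ Ω fun x => Real.log (u x)) {L : ℝ} (hL : 0 < L)
    (hlen : Metric.diam Ω * L < piP p) {φ : EuclideanSpace ℝ (Fin n) → ℝ}
    (hφ : ContDiff ℝ (⊤ : ℕ∞) φ) (hc : HasCompactSupport φ) (hs : tsupport φ ⊆ Ω) :
    ∃ c, 2 ^ (2 - p) * L ^ p * ∫ x in Ω, |φ x - c * u x| ^ p ≤
      (∫ x in Ω, ‖gradient φ x‖ ^ p) - lam * ∫ x in Ω, |φ x| ^ p := by
  obtain ⟨f, hf, hfc, -, hfu, hpic⟩ := picone hp hΩo huC hpos hweak hφ hc hs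
  have hp0 : 0 ≤ p := by linarith
  obtain ⟨c, hcle⟩ := poincare_logConcave_weight hn hp hΩo hΩb hΩc hL hlen
    (w := fun x => u x ^ p) (huC.continuousOn.rpow_const fun _ _ => Or.inr hp0)
    (fun x hx => Real.rpow_pos_of_pos (hpos x hx) _) (B := B ^ p)
    (fun x hx => Real.rpow_le_rpow (hpos x hx).le (huB x hx) hp0)
    (fun x hx y hy s t hs ht hst => by
      have hz : s • x + t • y ∈ Ω := hΩc hx hy hs.le ht.le hst
      have hux := hpos x hx
      have huy := hpos y hy
      have huz := hpos _ hz
      have h := hlc.2 hx hy hs.le ht.le hst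
      simp only [smul_eq_mul] at h
      rw [← Real.log_rpow hux, ← Real.log_rpow huy,
        ← Real.log_mul (by positivity) (by positivity),
        Real.log_le_log_iff (by positivity) huz] at h
      rw [← Real.rpow_mul hux.le, ← Real.rpow_mul huy.le, mul_comm p, mul_comm p,
        Real.rpow_mul hux.le, Real.rpow_mul huy.le, ← Real.mul_rpow (by positivity) (by positivity)]
      exact Real.rpow_le_rpow (by positivity) h hp0) hf hfc
  refine ⟨c, ?_⟩
  have e : ∫ x in Ω, |φ x - c * u x| ^ p = ∫ x in Ω, |f x - c| ^ p * u x ^ p := by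
    refine setIntegral_congr_fun hΩo.measurableSet fun x hx => ?_
    rw [hfu x hx, ← sub_mul, abs_mul, abs_of_pos (hpos x hx),
      Real.mul_rpow (abs_nonneg _) (hpos x hx).le]
  rw [e]
  have hLp : 0 < L ^ p := by positivity
  refine le_trans ?_ hpic
  rw [mul_assoc]
  refine mul_le_mul_of_nonneg_left ?_ (by positivity)
  calc L ^ p * ∫ x in Ω, |f x - c| ^ p * u x ^ p
      ≤ L ^ p * ((L ^ p)⁻¹ * ∫ x in Ω, ‖gradient f x‖ ^ p * u x ^ p) := by gcongr
    _ = _ := by rw [← mul_assoc, mul_inv_cancel₀ hLp.ne', one_mul]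

lemma rpow_one_sub_tendsto (p : ℝ) :
    Tendsto (fun t : ℝ => (1 - t) ^ (1 - p)) (nhdsWithin 0 (Set.Ioi 0)) (nhds 1) := by
  have h : ContinuousAt (fun t : ℝ => (1 - t) ^ (1 - p)) 0 :=
    (continuousAt_const.sub continuousAt_id).rpow_const (Or.inl (by simp))
  have := h.tendsto
  simp only [sub_zero, Real.one_rpow] at this
  exact this.mono_left nhdsWithin_le_nhds

/-- Fundamental gap estimate for the Dirichlet `p`-Laplacian on a bounded convex domain:
`λ₂ - λ₁ ≥ 2^{2-p} (π_p / diam Ω)^p · inf_c ∫ |u₂ - c u₁|^p`.  Here `u₁` is the (positive,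
log-concave, `L^p`-normalized) first eigenfunction and `u₂` is a second eigenfunction: a weak
solution of the eigenvalue equation with eigenvalue `λ₂ > λ₁`, `L^p`-normalized, with Dirichlet
energy `λ₂`, and belonging to the `W^{1,p}`-closure of smooth compactly supported functions. -/
theorem fundamental_gap_pLaplacian
    {n : ℕ} (hn : 2 ≤ n) {p : ℝ} (hp : 2 ≤ p)
    {Ω : Set (EuclideanSpace ℝ (Fin n))}
    (hΩo : IsOpen Ω) (hΩb : Bornology.IsBounded Ω) (hΩc : Convex ℝ Ω)
    (u₁ : EuclideanSpace ℝ (Fin n) → ℝ)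
    (hu₁C : ContDiffOn ℝ 1 u₁ Ω)
    (hu₁pos : ∀ x ∈ Ω, 0 < u₁ x)
    (hu₁cont : ContinuousOn u₁ (closure Ω))
    (hu₁bd : ∀ x ∈ frontier Ω, u₁ x = 0)
    (hu₁eig : ∀ φ : EuclideanSpace ℝ (Fin n) → ℝ,
      ContDiff ℝ (⊤ : ℕ∞) φ → HasCompactSupport φ → tsupport φ ⊆ Ω →
      ∫ x in Ω, ‖gradient u₁ x‖ ^ (p - 2) * ⟪gradient u₁ x, gradient φ x⟫
        = lambda1 n p Ω * ∫ x in Ω, |u₁ x| ^ (p - 2) * u₁ x * φ x)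
    (hu₁lc : ConcaveOn ℝ Ω fun x => Real.log (u₁ x))
    (hu₁norm : ∫ x in Ω, |u₁ x| ^ p = 1)
    (lam2 : ℝ) (hgap : lambda1 n p Ω < lam2)
    (u₂ : EuclideanSpace ℝ (Fin n) → ℝ)
    (hu₂C : ContDiffOn ℝ 1 u₂ Ω)
    (hu₂cont : ContinuousOn u₂ (closure Ω))
    (hu₂bd : ∀ x ∈ frontier Ω, u₂ x = 0)
    (hu₂eig : ∀ φ : EuclideanSpace ℝ (Fin n) → ℝ,
      ContDiff ℝ (⊤ : ℕ∞) φ → HasCompactSupport φ → tsupport φ ⊆ Ω →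
      ∫ x in Ω, ‖gradient u₂ x‖ ^ (p - 2) * ⟪gradient u₂ x, gradient φ x⟫
        = lam2 * ∫ x in Ω, |u₂ x| ^ (p - 2) * u₂ x * φ x)
    (hu₂norm : ∫ x in Ω, |u₂ x| ^ p = 1)
    (hu₂energy : ∫ x in Ω, ‖gradient u₂ x‖ ^ p = lam2)
    (hu₂dens : ∃ φ : ℕ → (EuclideanSpace ℝ (Fin n) → ℝ),
      (∀ k, ContDiff ℝ (⊤ : ℕ∞) (φ k) ∧ HasCompactSupport (φ k) ∧ tsupport (φ k) ⊆ Ω) ∧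
      Tendsto (fun k => ∫ x in Ω, ‖gradient (φ k) x - gradient u₂ x‖ ^ p) atTop (nhds 0) ∧
      Tendsto (fun k => ∫ x in Ω, |φ k x - u₂ x| ^ p) atTop (nhds 0)) :
    lam2 - lambda1 n p Ω
      ≥ (2 : ℝ) ^ (2 - p) * (piP p / Metric.diam Ω) ^ p *
        ⨅ c : ℝ, ∫ x in Ω, |u₂ x - c * u₁ x| ^ p := by
  have hp0 : 0 ≤ p := by linarith
  have hp1 : 1 ≤ p := by linarith
  have hΩm := hΩo.measurableSet
  have hcpt : IsCompact (closure Ω) := hΩb.isCompact_closure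
  have hfin := hΩb.measure_lt_top (μ := volume)
  have hlam : 0 ≤ lambda1 n p Ω := by
    refine Real.sInf_nonneg ?_
    rintro r ⟨u, -, -, -, -, rfl⟩
    exact div_nonneg (integral_nonneg fun x => by positivity)
      (integral_nonneg fun x => by positivity)
  set lam1 := lambda1 n p Ω with hlam1
  have hInt : ∀ {F : Type} [NormedAddCommGroup F], ∀ u : EuclideanSpace ℝ (Fin n) → F,
      ContinuousOn u (closure Ω) → IntegrableOn (fun x => ‖u x‖ ^ p) Ω := fun u hu =>
    ((hu.norm.rpow_const fun _ _ => Or.inr hp0).integrableOn_compact hcpt).mono_set subset_closure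
  have hgap0 : 0 ≤ lam2 - lam1 := by linarith
  set A := ⨅ c : ℝ, ∫ x in Ω, |u₂ x - c * u₁ x| ^ p with hA
  have hAle : ∀ c, A ≤ ∫ x in Ω, |u₂ x - c * u₁ x| ^ p := fun c =>
    ciInf_le ⟨0, by rintro _ ⟨c, rfl⟩; exact integral_nonneg fun x => by positivity⟩ c
  obtain ⟨B, hB⟩ := hcpt.exists_bound_of_continuousOn hu₁cont
  have huB : ∀ x ∈ Ω, u₁ x ≤ B := fun x hx => (le_abs_self _).trans (hB x (subset_closure hx))
  obtain ⟨φ, hφ, hgrad, hval⟩ := hu₂dens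
  have hg2 : IntegrableOn (fun x => ‖gradient u₂ x‖ ^ p) Ω := by
    by_contra h
    rw [integral_undef h] at hu₂energy
    linarith
  have hφ1 : ∀ k, ContDiff ℝ 1 (φ k) := fun k => (hφ k).1.of_le (by exact_mod_cast le_top)
  -- the estimate for a fixed admissible length scale and a fixed splitting parameter
  have main : ∀ L > 0, Metric.diam Ω * L < piP p → ∀ t ∈ Set.Ioo (0 : ℝ) 1,
      2 ^ (2 - p) * L ^ p * A ≤
        (1 - t) ^ (1 - p) * ((1 - t) ^ (1 - p) * lam2) - lam1 := by
    intro L hL hlen t ht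
    have ht0 := ht.1
    have ht1 : 0 < 1 - t := by linarith [ht.2]
    set r := (1 - t) ^ (1 - p) with hr
    set s := t ^ (1 - p) with hs
    set κ := (2 : ℝ) ^ (2 - p) * L ^ p with hκ
    have hr0 : 0 ≤ r := by positivity
    have hκ0 : 0 ≤ κ := by positivity
    set d := fun k => ∫ x in Ω, ‖gradient (φ k) x - gradient u₂ x‖ ^ p with hd
    set b := fun k => ∫ x in Ω, |φ k x - u₂ x| ^ p with hb
    have hk : ∀ k, κ * A ≤ r * (r * lam2 + s * d k) - lam1 * (1 - s * b k) + κ * (s * b k) := by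
      intro k
      obtain ⟨hφk, hφc, hφs⟩ := hφ k
      obtain ⟨c, hc⟩ := gap_stability hn hp hΩo hΩb hΩc hu₁C hu₁pos huB hu₁eig hu₁lc hL hlen
        hφk hφc hφs
      have cφ : ContinuousOn (φ k) (closure Ω) := hφk.continuous.continuousOn
      have hb' : ∫ x in Ω, |u₂ x - φ k x| ^ p = b k := by simp only [hb, abs_sub_comm]
      have e1 : A ≤ r * (∫ x in Ω, |φ k x - c * u₁ x| ^ p) + s * b k := by
        refine (hAle c).trans ?_
        have := integral_norm_add_rpow_le hp1 (μ := volume.restrict Ω)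
          (hInt (fun x => φ k x - c * u₁ x) (cφ.sub (hu₁cont.const_mul c)))
          (hInt (fun x => u₂ x - φ k x) (hu₂cont.sub cφ)) ht
        simp only [Real.norm_eq_abs] at this
        refine Eq.trans_le ?_ (this.trans_eq ?_)
        · congr 1; funext x; congr 2; ring
        · rw [hb']
      have e2 : ∫ x in Ω, ‖gradient (φ k) x‖ ^ p ≤ r * lam2 + s * d k := by
        have := integral_norm_add_rpow_le hp1 (μ := volume.restrict Ω) hg2
          (integrable_norm_sub_rpow hp1
            (continuous_gradient (hφ1 k)).aestronglyMeasurable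
            ((continuousOn_gradient hΩo hu₂C).aestronglyMeasurable hΩm)
            (hInt (gradient (φ k)) (continuous_gradient (hφ1 k)).continuousOn) hg2) ht
        simp only [add_sub_cancel] at this
        rwa [hu₂energy] at this
      have e3 : 1 ≤ r * (∫ x in Ω, |φ k x| ^ p) + s * b k := by
        have := integral_norm_add_rpow_le hp1 (μ := volume.restrict Ω)
          (hInt (φ k) cφ) (hInt (fun x => u₂ x - φ k x) (hu₂cont.sub cφ)) ht
        simp only [Real.norm_eq_abs, add_sub_cancel] at this
        rw [hu₂norm] at this
        rwa [hb'] at this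
      have f1 := mul_le_mul_of_nonneg_left e1 hκ0
      have f2 := mul_le_mul_of_nonneg_left hc hr0
      have f3 := mul_le_mul_of_nonneg_left e2 hr0
      have f4 := mul_le_mul_of_nonneg_left e3 hlam
      linarith
    have hlim : Tendsto (fun k => r * (r * lam2 + s * d k) - lam1 * (1 - s * b k) + κ * (s * b k))
        atTop (nhds (r * (r * lam2 + s * 0) - lam1 * (1 - s * 0) + κ * (s * 0))) :=
      (((hgrad.const_mul s).const_add _).const_mul r |>.sub
        (((hval.const_mul s).const_sub 1).const_mul lam1)).add ((hval.const_mul s).const_mul κ)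
    have := ge_of_tendsto' hlim hk
    linarith
  have main' : ∀ L > 0, Metric.diam Ω * L < piP p → 2 ^ (2 - p) * L ^ p * A ≤ lam2 - lam1 := by
    intro L hL hlen
    have h1 := rpow_one_sub_tendsto p
    have hlim := (h1.mul (h1.mul_const lam2)).sub_const lam1
    simp only [one_mul] at hlim
    refine ge_of_tendsto hlim ?_
    filter_upwards [Ioo_mem_nhdsGT (zero_lt_one (α := ℝ))] with t ht
    exact main L hL hlen t ht
  rcases (Metric.diam_nonneg (s := Ω)).eq_or_lt with hd0 | hd0
  · rw [← hd0, div_zero, Real.zero_rpow (by linarith), mul_zero, zero_mul]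
    exact hgap0
  · have hL0 : 0 < piP p / Metric.diam Ω := div_pos (piP_pos (by linarith)) hd0
    have hcont : Tendsto (fun L : ℝ => (2 : ℝ) ^ (2 - p) * L ^ p * A)
        (nhdsWithin (piP p / Metric.diam Ω) (Set.Iio (piP p / Metric.diam Ω)))
        (nhds ((2 : ℝ) ^ (2 - p) * (piP p / Metric.diam Ω) ^ p * A)) :=
      (((continuous_id.rpow_const fun _ => Or.inr hp0).const_mul _).mul_const A).continuousAt
        |>.tendsto.mono_left nhdsWithin_le_nhds
    refine le_of_tendsto hcont ?_
    filter_upwards [Ioo_mem_nhdsLT hL0] with L hL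
    refine main' L hL.1 ?_
    rw [mul_comm]
    exact (lt_div_iff₀ hd0).1 hL.2
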